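/- G = pei(S), for S an orthohedral set, satisfies the maximal condition on normal subgroups, and the rank subgroups G_k are characteristic in G. -/

import Mathlib

open Pointwise

namespace PeiPaper

/-- Points of the face of the standard orthant spanned by the canonical basis vectors in `Y`. -/
def stdFace (N : ℕ) (Y : Finset (Fin N)) : Set (Fin N → ℤ) :=
  {v | (∀ i, 0 ≤ v i) ∧ ∀ i, i ∉ Y → v i = 0}

/-- Integral orthogonal matrix. -/
def IsOrthMat {N : ℕ} (A : Matrix (Fin N) (Fin N) ℤ) : Prop :=
  A * A.transpose = 1

/-- `L` is an integral orthant of rank `k` in `ℤ^N`: an affine-orthogonal image of a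
rank-`k` face of the standard orthant. -/
def IsOrthantOfRank {N : ℕ} (L : Set (Fin N → ℤ)) (k : ℕ) : Prop :=
  ∃ (a : Fin N → ℤ) (A : Matrix (Fin N) (Fin N) ℤ) (Y : Finset (Fin N)),
    IsOrthMat A ∧ Y.card = k ∧ L = (fun v => a + A.mulVec v) '' stdFace N Y

def IsOrthant {N : ℕ} (L : Set (Fin N → ℤ)) : Prop := ∃ k, IsOrthantOfRank L k

/-- `S` is orthohedral: a finite union of integral orthants. -/
def IsOrthohedral {N : ℕ} (S : Set (Fin N → ℤ)) : Prop :=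
  ∃ 𝓛 : Set (Set (Fin N → ℤ)), 𝓛.Finite ∧ (∀ L ∈ 𝓛, IsOrthant L) ∧ S = ⋃₀ 𝓛

/-- The rank of a set: the maximal rank of an orthant contained in it. -/
noncomputable def orthRank {N : ℕ} (S : Set (Fin N → ℤ)) : ℕ :=
  sSup {k | ∃ L, IsOrthantOfRank L k ∧ L ⊆ S}

/-- Commensurability: the intersection is nonempty and has the same rank as both sets. -/
def Commensurable {N : ℕ} (L L' : Set (Fin N → ℤ)) : Prop :=
  (L ∩ L').Nonempty ∧ orthRank L = orthRank (L ∩ L') ∧ orthRank L' = orthRank (L ∩ L')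

/-- The rank-`k` orthants contained in `S`. -/
def germSet {N : ℕ} (S : Set (Fin N → ℤ)) (k : ℕ) : Set (Set (Fin N → ℤ)) :=
  {L | IsOrthantOfRank L k ∧ L ⊆ S}

/-- The rank-`k` germs of `S`: commensurability classes of rank-`k` orthants of `S`. -/
def Germ {N : ℕ} (S : Set (Fin N → ℤ)) (k : ℕ) : Type _ :=
  Quot (fun L L' : germSet S k => Commensurable L.1 L'.1)

def germOf {N : ℕ} (S : Set (Fin N → ℤ)) (k : ℕ) (L : germSet S k) : Germ S k :=
  Quot.mk _ L

/-- The number of rank-`k` germs of `S` (as a natural number; `0` if infinite). -/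
noncomputable def heightAt {N : ℕ} (S : Set (Fin N → ℤ)) (k : ℕ) : ℕ :=
  Nat.card (Germ S k)

/-- The height of an orthohedral set: the number of germs of maximal rank. -/
noncomputable def height {N : ℕ} (S : Set (Fin N → ℤ)) : ℕ :=
  heightAt S (orthRank S)

/-- `f` is (the restriction of) an isometry of `ℤ^N` on `L`. -/
def IsometricOn {N : ℕ} (f : (Fin N → ℤ) → (Fin N → ℤ)) (L : Set (Fin N → ℤ)) : Prop :=
  ∃ (a : Fin N → ℤ) (A : Matrix (Fin N) (Fin N) ℤ),
    IsOrthMat A ∧ ∀ x ∈ L, f x = a + A.mulVec x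

/-- `f` is (the restriction of) a translation on `L`. -/
def TranslationOn {N : ℕ} (f : (Fin N → ℤ) → (Fin N → ℤ)) (L : Set (Fin N → ℤ)) : Prop :=
  ∃ a : Fin N → ℤ, ∀ x ∈ L, f x = a + x

/-- `f` is a piecewise-Euclidean-isometric map on `S`. -/
def IsPeiMapOn {N : ℕ} (S : Set (Fin N → ℤ)) (f : (Fin N → ℤ) → (Fin N → ℤ)) : Prop :=
  ∃ 𝓛 : Set (Set (Fin N → ℤ)), 𝓛.Finite ∧ (∀ L ∈ 𝓛, IsOrthant L) ∧
    S = ⋃₀ 𝓛 ∧ 𝓛.PairwiseDisjoint id ∧ ∀ L ∈ 𝓛, IsometricOn f L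

/-- `f` is a piecewise-Euclidean-translation map on `S`. -/
def IsPetMapOn {N : ℕ} (S : Set (Fin N → ℤ)) (f : (Fin N → ℤ) → (Fin N → ℤ)) : Prop :=
  ∃ 𝓛 : Set (Set (Fin N → ℤ)), 𝓛.Finite ∧ (∀ L ∈ 𝓛, IsOrthant L) ∧
    S = ⋃₀ 𝓛 ∧ 𝓛.PairwiseDisjoint id ∧ ∀ L ∈ 𝓛, TranslationOn f L

def IsPeiIso {N : ℕ} (S S' : Set (Fin N → ℤ)) (f : (Fin N → ℤ) → (Fin N → ℤ)) : Prop :=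
  IsPeiMapOn S f ∧ Set.InjOn f S ∧ f '' S = S'

def PeiIsomorphic {N : ℕ} (S S' : Set (Fin N → ℤ)) : Prop := ∃ f, IsPeiIso S S' f

def IsPetIso {N : ℕ} (S S' : Set (Fin N → ℤ)) (f : (Fin N → ℤ) → (Fin N → ℤ)) : Prop :=
  IsPetMapOn S f ∧ Set.InjOn f S ∧ f '' S = S'

def PetIsomorphic {N : ℕ} (S S' : Set (Fin N → ℤ)) : Prop := ∃ f, IsPetIso S S' f

/-- A pei-permutation of `S`: a permutation of `ℤ^N` supported on `S` which is pei on `S`. -/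
def IsPeiPerm {N : ℕ} (S : Set (Fin N → ℤ)) (g : Equiv.Perm (Fin N → ℤ)) : Prop :=
  IsPeiMapOn S ⇑g ∧ ∀ x ∉ S, g x = x

/-- The element `g` has rank at most `k`: it is supported on an orthohedral set of rank `≤ k`. -/
def rankLE {N : ℕ} (g : Equiv.Perm (Fin N → ℤ)) (k : ℕ) : Prop :=
  ∃ T : Set (Fin N → ℤ), IsOrthohedral T ∧ orthRank T ≤ k ∧ ∀ x ∉ T, g x = x

/-- `g` fixes every rank-`k` germ of `S`. -/
def FixesGerm {N : ℕ} (S : Set (Fin N → ℤ)) (k : ℕ) (g : Equiv.Perm (Fin N → ℤ)) : Prop :=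
  ∀ L, IsOrthantOfRank L k → L ⊆ S →
    ∃ L', IsOrthantOfRank L' k ∧ L' ⊆ L ∧ Commensurable L L' ∧
      IsometricOn (⇑g) L' ∧ Commensurable (⇑g '' L') L

/-- `g` fixes every rank-`k` germ of `S` and acts on its tangent coset by a translation. -/
def TranslatesGerm {N : ℕ} (S : Set (Fin N → ℤ)) (k : ℕ) (g : Equiv.Perm (Fin N → ℤ)) : Prop :=
  ∀ L, IsOrthantOfRank L k → L ⊆ S →
    ∃ L' a, IsOrthantOfRank L' k ∧ L' ⊆ L ∧ Commensurable L L' ∧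
      (∀ x ∈ L', g x = a + x) ∧ Commensurable (⇑g '' L') L

/-- `σ` is the map induced by `g` on the rank-`k` germs of `S`. -/
def InducesGermMap {N : ℕ} (S : Set (Fin N → ℤ)) (k : ℕ) (g : Equiv.Perm (Fin N → ℤ))
    (σ : Germ S k → Germ S k) : Prop :=
  ∀ L : germSet S k, ∃ (L'' : Set (Fin N → ℤ)) (M : germSet S k),
    IsOrthantOfRank L'' k ∧ L'' ⊆ L.1 ∧ Commensurable L.1 L'' ∧
    M.1 = ⇑g '' L'' ∧ σ (germOf S k L) = germOf S k M

/-- A finitary permutation which is even (has sign `1` on a finite invariant subset). -/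
def IsEvenFinitary {α : Type*} (σ : Equiv.Perm α) : Prop :=
  ∃ (F : Finset α) (σF : Equiv.Perm F),
    (∀ a ∉ F, σ a = a) ∧ (∀ a : F, σ (a : α) = (σF a : α)) ∧
    @Equiv.Perm.sign F (Classical.decEq _) inferInstance σF = 1

/-- `g` induces an even finitary permutation on the rank-`k` germs of `S`. -/
def IsEvenOnGerms {N : ℕ} (S : Set (Fin N → ℤ)) (k : ℕ) (g : Equiv.Perm (Fin N → ℤ)) : Prop :=
  ∃ σ : Equiv.Perm (Germ S k), InducesGermMap S k g ⇑σ ∧ IsEvenFinitary σ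

/-- Ordering of germs (of arbitrary ranks): `p ≤ q` if they have representatives `L ⊆ L'`. -/
def germLE {N : ℕ} (S : Set (Fin N → ℤ)) (p q : Σ k, Germ S k) : Prop :=
  ∃ (L : germSet S p.1) (L' : germSet S q.1),
    germOf S p.1 L = p.2 ∧ germOf S q.1 L' = q.2 ∧ L.1 ⊆ L'.1

/-- A maximal germ of `S`. -/
def IsMaxGerm {N : ℕ} (S : Set (Fin N → ℤ)) (p : Σ k, Germ S k) : Prop :=
  ∀ q, germLE S p q → germLE S q p

/-- A `0`-based orthant. -/
def IsBasedOrthant {N : ℕ} (L0 : Set (Fin N → ℤ)) : Prop :=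
  ∃ (A : Matrix (Fin N) (Fin N) ℤ) (Y : Finset (Fin N)),
    IsOrthMat A ∧ L0 = (fun v => A.mulVec v) '' stdFace N Y

/-- Two (oriented) parallel orthants. -/
def ParallelOrthants {N : ℕ} (L L' : Set (Fin N → ℤ)) : Prop :=
  ∃ a : Fin N → ℤ, L' = a +ᵥ L

/-- The indicator image `S_τ` of `S`: the union of the `0`-based parallel translates of
the orthants contained in `S`. -/
def indicatorImage {N : ℕ} (S : Set (Fin N → ℤ)) : Set (Fin N → ℤ) :=
  ⋃₀ {L0 | IsBasedOrthant L0 ∧ ∃ a : Fin N → ℤ, (a +ᵥ L0) ⊆ S}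

/-- The height function `h_S`: the number of maximal germs of `S` whose indicator is `L0`. -/
noncomputable def hFun {N : ℕ} (S : Set (Fin N → ℤ)) (L0 : Set (Fin N → ℤ)) : ℕ :=
  Nat.card {p : Σ k, Germ S k //
    IsMaxGerm S p ∧ ∃ L : germSet S p.1, germOf S p.1 L = p.2 ∧ ∃ a : Fin N → ℤ, L.1 = a +ᵥ L0}

/-- `S` is quasi-normal: the maximal based orthants of `S_τ` are exactly the support of `h_S`. -/
def QuasiNormal {N : ℕ} (S : Set (Fin N → ℤ)) : Prop :=
  ∀ L0 : Set (Fin N → ℤ),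
    (IsBasedOrthant L0 ∧ L0 ⊆ indicatorImage S ∧
      ∀ L1, IsBasedOrthant L1 → L1 ⊆ indicatorImage S → L0 ⊆ L1 → L1 ⊆ L0)
    ↔ (IsBasedOrthant L0 ∧ 0 < hFun S L0)

/-- The germ `q` of `S'` is the image of the germ `p` of `S` under the injective pei-map `f`. -/
def GermMapsTo {N : ℕ} (f : (Fin N → ℤ) → (Fin N → ℤ)) (S S' : Set (Fin N → ℤ))
    (p : Σ k, Germ S k) (q : Σ k, Germ S' k) : Prop :=
  p.1 = q.1 ∧ ∃ (L : germSet S p.1) (L'' : Set (Fin N → ℤ)) (M : germSet S' q.1),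
    germOf S p.1 L = p.2 ∧ IsOrthantOfRank L'' p.1 ∧ L'' ⊆ L.1 ∧ Commensurable L.1 L'' ∧
    M.1 = f '' L'' ∧ germOf S' q.1 M = q.2

/-- A stack of `h` parallel rank-`n` orthants. -/
def IsStack {N : ℕ} (S : Set (Fin N → ℤ)) (n h : ℕ) : Prop :=
  ∃ (L0 : Set (Fin N → ℤ)) (a : Fin h → (Fin N → ℤ)),
    IsOrthantOfRank L0 n ∧
    (Pairwise fun i j => Disjoint (a i +ᵥ L0) (a j +ᵥ L0)) ∧
    S = ⋃ i, a i +ᵥ L0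

/-- A coordinate half-space of `ℤ^N`. -/
def IsHalfSpace {N : ℕ} (H : Set (Fin N → ℤ)) : Prop :=
  ∃ (i : Fin N) (c : ℤ), H = {x | x i ≤ c} ∨ H = {x | c ≤ x i}

/-- The canonical embedding `ℤ^N → ℤ^{N+1}`. -/
def emb (N : ℕ) (x : Fin N → ℤ) : Fin (N + 1) → ℤ :=
  fun i => if h : (i : ℕ) < N then x ⟨i, h⟩ else 0

/-- The sum of all matrix entries of a finitely supported family of vectors. -/
noncomputable def totalSum (k : ℕ) (Γ : Type*) : (Γ →₀ (Fin k → ℤ)) →+ ℤ :=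
  Finsupp.liftAddHom (fun _ => ∑ i : Fin k, Pi.evalAddMonoidHom (fun _ => ℤ) i)

/-- The clique (flag) complex of a graph. -/
def cliqueComplex {V : Type*} (G : SimpleGraph V) : Set (Finset V) :=
  {s | s.Nonempty ∧ G.IsClique (s : Set V)}

/-- The geometric realization of a simplicial complex on vertex set `V`. -/
def realization {V : Type*} (K : Set (Finset V)) : Set (V → ℝ) :=
  {f | (∀ v, 0 ≤ f v) ∧ ∃ s ∈ K, Function.support f ⊆ ↑s ∧ ∑ v ∈ s, f v = 1}

/-- A wedge (bouquet) of `n`-spheres indexed by `ι`, with basepoint `b`. -/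
noncomputable def wedgeSpheres (ι : Type) (n : ℕ)
    (b : Metric.sphere (0 : EuclideanSpace ℝ (Fin (n + 1))) 1) : Type :=
  Quot (fun p q : Unit ⊕ (ι × Metric.sphere (0 : EuclideanSpace ℝ (Fin (n + 1))) 1) =>
    (Sum.elim (fun _ => True) (fun pr => pr.2 = b) p) ∧
    (Sum.elim (fun _ => True) (fun qr => qr.2 = b) q))

noncomputable instance (ι : Type) (n : ℕ) (b : Metric.sphere (0 : EuclideanSpace ℝ (Fin (n + 1))) 1) :
    TopologicalSpace (wedgeSpheres ι n b) :=
  letI : TopologicalSpace ι := ⊥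
  instTopologicalSpaceQuot


section Helpers

variable {N : ℕ}

/-- Sign vectors, the directions of integral orthants. -/
def IsDir (ε : Fin N → ℤ) : Prop := ∀ i, ε i = -1 ∨ ε i = 0 ∨ ε i = 1

/-- The number of nonzero coordinates of a vector. -/
def dirRank (ε : Fin N → ℤ) : ℕ := (Finset.univ.filter fun i => ε i ≠ 0).card

/-- The orthant with apex `p` and direction `ε`. -/
def cone (p ε : Fin N → ℤ) : Set (Fin N → ℤ) :=
  {x | ∀ i, (ε i = 0 → x i = p i) ∧ 0 ≤ ε i * (x i - p i)}

/-- The discrete ray from `x` in direction `ε`. -/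
def ray (x ε : Fin N → ℤ) (t : ℕ) : Fin N → ℤ := fun i => x i + t * ε i

theorem orthMat_signed {A : Matrix (Fin N) (Fin N) ℤ} (hA : IsOrthMat A) :
    ∃ (σ : Equiv.Perm (Fin N)) (s : Fin N → ℤ), (∀ i, s i = 1 ∨ s i = -1) ∧
      ∀ v i, A.mulVec v i = s i * v (σ i) := by
  have hdot : ∀ i i', ∑ j, A i j * A i' j = if i = i' then 1 else 0 := by
    intro i i'
    have := congrFun (congrFun hA i) i'
    simpa [Matrix.mul_apply, Matrix.one_apply] using this
  have hrow : ∀ i, ∃ j, (A i j = 1 ∨ A i j = -1) ∧ ∀ j', j' ≠ j → A i j' = 0 := by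
    intro i
    have h1 : ∑ j, A i j * A i j = 1 := by simpa using hdot i i
    obtain ⟨j, hj⟩ : ∃ j, A i j ≠ 0 := by
      by_contra! h
      simp [h] at h1
    have hsplit : A i j * A i j + ∑ j' ∈ Finset.univ.erase j, A i j' * A i j' = 1 :=
      (Finset.add_sum_erase _ (fun j' => A i j' * A i j') (Finset.mem_univ j)).trans h1
    have hpos : 0 < A i j * A i j := mul_self_pos.2 hj
    have hnn : 0 ≤ ∑ j' ∈ Finset.univ.erase j, A i j' * A i j' :=
      Finset.sum_nonneg fun j' _ => mul_self_nonneg _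
    have hjj : A i j * A i j = 1 := by omega
    have hz : ∑ j' ∈ Finset.univ.erase j, A i j' * A i j' = 0 := by omega
    refine ⟨j, mul_self_eq_one_iff.1 hjj, fun j' hj' => ?_⟩
    have := (Finset.sum_eq_zero_iff_of_nonneg (fun j' _ => mul_self_nonneg (A i j'))).1 hz j'
      (by simp [hj'])
    exact mul_self_eq_zero.1 this
  choose f hf1 hf2 using hrow
  have hinj : Function.Injective f := by
    intro i i' h
    by_contra hne
    have h0 := hdot i i'
    rw [if_neg hne, Finset.sum_eq_single (f i)] at h0
    · have h2 := hf1 i'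
      rw [← h] at h2
      rcases hf1 i with h1 | h1 <;> rcases h2 with h2 | h2 <;> rw [h1, h2] at h0 <;> simp at h0
    · intro j _ hj
      rw [hf2 i j hj, zero_mul]
    · simp
  refine ⟨Equiv.ofBijective f (Finite.injective_iff_bijective.1 hinj), fun i => A i (f i), hf1, ?_⟩
  intro v i
  rw [Matrix.mulVec, dotProduct, Finset.sum_eq_single (f i)]
  · rfl
  · intro j _ hj
    rw [hf2 i j hj, zero_mul]
  · simp

theorem exists_orthMat_of_signed (σ : Equiv.Perm (Fin N)) (s : Fin N → ℤ)
    (hs : ∀ i, s i = 1 ∨ s i = -1) :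
    ∃ A : Matrix (Fin N) (Fin N) ℤ, IsOrthMat A ∧ ∀ v i, A.mulVec v i = s i * v (σ i) := by
  refine ⟨Matrix.of fun i j => if j = σ i then s i else 0, ?_, ?_⟩
  · ext i i'
    simp only [Matrix.mul_apply, Matrix.transpose_apply, Matrix.of_apply, Matrix.one_apply]
    rw [Finset.sum_eq_single (σ i)]
    · by_cases h : i = i'
      · subst h
        rcases hs i with h | h <;> simp [h]
      · simp [h]
    · intro j _ hj
      simp [hj]
    · simp
  · intro v i
    simp [Matrix.mulVec, dotProduct]

theorem IsOrthMat.transpose_mul {A : Matrix (Fin N) (Fin N) ℤ} (hA : IsOrthMat A) :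
    A.transpose * A = 1 := mul_eq_one_comm.1 hA

theorem IsOrthMat.transpose {A : Matrix (Fin N) (Fin N) ℤ} (hA : IsOrthMat A) :
    IsOrthMat A.transpose := by
  unfold IsOrthMat
  rw [Matrix.transpose_transpose]
  exact hA.transpose_mul

theorem isOrthMat_one : IsOrthMat (1 : Matrix (Fin N) (Fin N) ℤ) := by
  simp [IsOrthMat]

theorem IsDir.mulVec {A : Matrix (Fin N) (Fin N) ℤ} (hA : IsOrthMat A) {ε : Fin N → ℤ}
    (hε : IsDir ε) : IsDir (A.mulVec ε) := by
  obtain ⟨σ, s, hs, h⟩ := orthMat_signed hA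
  intro i
  rw [h]
  rcases hs i with h1 | h1 <;> rcases hε (σ i) with h2 | h2 | h2 <;> simp [h1, h2]

theorem dirRank_mulVec {A : Matrix (Fin N) (Fin N) ℤ} (hA : IsOrthMat A) (ε : Fin N → ℤ) :
    dirRank (A.mulVec ε) = dirRank ε := by
  obtain ⟨σ, s, hs, h⟩ := orthMat_signed hA
  unfold dirRank
  refine Finset.card_bij (fun i _ => σ i) ?_ ?_ ?_
  · intro i hi
    rw [Finset.mem_filter, h] at hi
    simpa using right_ne_zero_of_mul hi.2
  · intro i _ j _ hij
    exact σ.injective hij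
  · intro j hj
    refine ⟨σ.symm j, ?_, by simp⟩
    rw [Finset.mem_filter, h]
    have : s (σ.symm j) ≠ 0 := by rcases hs (σ.symm j) with h | h <;> simp [h]
    simpa [this] using hj

theorem mulVec_ray (A : Matrix (Fin N) (Fin N) ℤ) (a x ε : Fin N → ℤ) (t : ℕ) :
    a + A.mulVec (ray x ε t) = ray (a + A.mulVec x) (A.mulVec ε) t := by
  have : ray x ε t = x + (t : ℤ) • ε := by ext i; simp [ray]
  rw [this, Matrix.mulVec_add, Matrix.mulVec_smul]
  ext i
  simp [ray, add_assoc]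

theorem mulVec_mem_cone {A : Matrix (Fin N) (Fin N) ℤ} (hA : IsOrthMat A) {a p ε x : Fin N → ℤ}
    (hx : x ∈ cone p ε) : a + A.mulVec x ∈ cone (a + A.mulVec p) (A.mulVec ε) := by
  obtain ⟨σ, s, hs, h⟩ := orthMat_signed hA
  intro i
  obtain ⟨h1, h2⟩ := hx (σ i)
  simp only [Pi.add_apply, h]
  rcases hs i with h3 | h3
  · simp only [h3, one_mul]
    refine ⟨fun h4 => by rw [h1 h4], by convert h2 using 2; ring⟩
  · simp only [h3]
    refine ⟨fun h4 => by rw [h1 (by simpa using h4)], by convert h2 using 1; ring⟩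

theorem image_cone {A : Matrix (Fin N) (Fin N) ℤ} (hA : IsOrthMat A) (a p ε : Fin N → ℤ) :
    (fun v => a + A.mulVec v) '' cone p ε = cone (a + A.mulVec p) (A.mulVec ε) := by
  apply Set.Subset.antisymm
  · rintro _ ⟨x, hx, rfl⟩
    exact mulVec_mem_cone hA hx
  · intro y hy
    refine ⟨A.transpose.mulVec (y - a), ?_, ?_⟩
    · have := mulVec_mem_cone hA.transpose (a := -A.transpose.mulVec a) hy
      simp only [Matrix.mulVec_add, Matrix.mulVec_mulVec, hA.transpose_mul,
        Matrix.one_mulVec, neg_add_cancel_left] at this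
      rwa [Matrix.mulVec_sub, sub_eq_neg_add]
    · simp only [Matrix.mulVec_mulVec]
      rw [hA, Matrix.one_mulVec]
      abel

theorem stdFace_eq_cone (Y : Finset (Fin N)) :
    stdFace N Y = cone 0 (fun i => if i ∈ Y then 1 else 0) := by
  ext v
  simp only [stdFace, cone, Set.mem_ofPred_eq]
  constructor
  · rintro ⟨h1, h2⟩ i
    by_cases hi : i ∈ Y <;> simp [hi, h1, h2]
  · intro h
    constructor
    · intro i
      have := h i
      by_cases hi : i ∈ Y
      · simpa [hi] using this
      · simp only [hi, if_false] at this
        rw [this.1 trivial]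
        rfl
    · intro i hi
      have := h i
      simpa [hi] using this

theorem isOrthantOfRank_iff {L : Set (Fin N → ℤ)} {k : ℕ} :
    IsOrthantOfRank L k ↔ ∃ p ε, IsDir ε ∧ dirRank ε = k ∧ L = cone p ε := by
  constructor
  · rintro ⟨a, A, Y, hA, hY, rfl⟩
    have hd : IsDir (fun i : Fin N => if i ∈ Y then (1 : ℤ) else 0) := by
      intro i
      by_cases hi : i ∈ Y <;> simp [hi]
    rw [stdFace_eq_cone, image_cone hA]
    refine ⟨_, _, hd.mulVec hA, ?_, rfl⟩
    rw [dirRank_mulVec hA, ← hY]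
    simp [dirRank]
  · rintro ⟨p, ε, hε, hk, rfl⟩
    obtain ⟨A, hA, h⟩ := exists_orthMat_of_signed (Equiv.refl (Fin N))
      (fun i => if ε i = 0 then 1 else ε i) (by
        intro i
        rcases hε i with h | h | h <;> simp [h])
    refine ⟨p, A, Finset.univ.filter fun i => ε i ≠ 0, hA, hk, ?_⟩
    rw [stdFace_eq_cone, image_cone hA]
    congr 1
    · simp
    · ext i
      rw [h]
      rcases hε i with h | h | h <;> simp [h]

theorem isOrthant_iff {L : Set (Fin N → ℤ)} :
    IsOrthant L ↔ ∃ p ε, IsDir ε ∧ L = cone p ε := by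
  constructor
  · rintro ⟨k, hk⟩
    obtain ⟨p, ε, h1, -, h2⟩ := isOrthantOfRank_iff.1 hk
    exact ⟨p, ε, h1, h2⟩
  · rintro ⟨p, ε, h1, h2⟩
    exact ⟨_, isOrthantOfRank_iff.2 ⟨p, ε, h1, rfl, h2⟩⟩

theorem dirRank_le_of_match {ε η : Fin N → ℤ} (h : ∀ i, ε i ≠ 0 → η i = ε i) :
    dirRank ε ≤ dirRank η := by
  refine Finset.card_le_card fun i hi => ?_
  simp only [Finset.mem_filter, Finset.mem_univ, true_and] at hi ⊢
  rwa [h i hi]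

theorem eq_of_match_of_dirRank_le {ε η : Fin N → ℤ} (h : ∀ i, ε i ≠ 0 → η i = ε i)
    (hle : dirRank η ≤ dirRank ε) : η = ε := by
  have hsub : (Finset.univ.filter fun i => ε i ≠ 0) ⊆ Finset.univ.filter fun i => η i ≠ 0 := by
    intro i hi
    simp only [Finset.mem_filter, Finset.mem_univ, true_and] at hi ⊢
    rwa [h i hi]
  have heq := Finset.eq_of_subset_of_card_le hsub hle
  ext i
  by_cases hi : ε i = 0
  · have : i ∉ Finset.univ.filter fun i => ε i ≠ 0 := by simp [hi]
    rw [heq] at this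
    rw [hi]
    simpa using this
  · exact h i hi

theorem ray_eventually_inj {x ε y δ : Fin N → ℤ}
    (h : ∀ᶠ t in Filter.atTop, ray x ε t = ray y δ t) : x = y ∧ ε = δ := by
  obtain ⟨t, ht⟩ := Filter.eventually_atTop.1 h
  have h0 := ht t le_rfl
  have h1 := ht (t + 1) (Nat.le_succ t)
  have key : ∀ i, ε i = δ i := by
    intro i
    have e0 := congrFun h0 i
    have e1 := congrFun h1 i
    simp only [ray] at e0 e1
    push_cast at e1
    linarith
  refine ⟨?_, funext key⟩
  ext i
  have e0 := congrFun h0 i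
  simp only [ray, key i] at e0
  linarith

theorem ray_mem_cone {p ε x : Fin N → ℤ} (hx : x ∈ cone p ε) (t : ℕ) : ray x ε t ∈ cone p ε := by
  intro i
  obtain ⟨h1, h2⟩ := hx i
  refine ⟨fun h => by simp [ray, h, h1 h], ?_⟩
  simp only [ray]
  nlinarith [mul_nonneg (Int.natCast_nonneg t) (mul_self_nonneg (ε i))]

theorem self_mem_cone (p ε : Fin N → ℤ) : p ∈ cone p ε := fun i => by simp

theorem ray_frequently_cone {x ε p η : Fin N → ℤ} (hε : IsDir ε) (hη : IsDir η)
    (h : ∃ᶠ t in Filter.atTop, ray x ε t ∈ cone p η) :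
    (∀ i, ε i ≠ 0 → η i = ε i) ∧
      ∀ i, ε i = 0 → ((η i = 0 → x i = p i) ∧ 0 ≤ η i * (x i - p i)) := by
  rw [Filter.frequently_atTop] at h
  constructor
  · intro i hi
    obtain ⟨t, ht, hm⟩ := h ((x i - p i).natAbs + 1)
    obtain ⟨h1, h2⟩ := hm i
    simp only [ray] at h1 h2
    rcases hε i with e | e | e <;> rcases hη i with n | n | n <;>
      simp only [e, n, forall_const] at * <;> omega
  · intro i hi
    obtain ⟨t, ht, hm⟩ := h 0
    simpa [ray, hi] using hm i

theorem eventually_cone_ray_subset {x ε p η : Fin N → ℤ} (hε : IsDir ε)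
    (h1 : ∀ i, ε i ≠ 0 → η i = ε i)
    (h2 : ∀ i, ε i = 0 → ((η i = 0 → x i = p i) ∧ 0 ≤ η i * (x i - p i)))
    {y : Fin N → ℤ} (hy : ∀ i, ε i = 0 → y i = x i) :
    ∀ᶠ t in Filter.atTop, cone (ray y ε t) ε ⊆ cone p η := by
  have : ∀ i, ∀ᶠ t in Filter.atTop, ∀ z ∈ cone (ray y ε t) ε,
      (η i = 0 → z i = p i) ∧ 0 ≤ η i * (z i - p i) := by
    intro i
    by_cases hi : ε i = 0
    · refine Filter.Eventually.of_forall fun t z hz => ?_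
      have : z i = x i := by
        rw [(hz i).1 hi, ← hy i hi]
        simp [ray, hi]
      rw [this]
      exact h2 i hi
    · filter_upwards [Filter.eventually_ge_atTop (y i - p i).natAbs] with t ht z hz
      obtain ⟨-, h4⟩ := hz i
      simp only [ray] at h4
      rw [h1 i hi]
      rcases hε i with e | e | e <;> simp only [e] at * <;> first | omega | simp at hi
  filter_upwards [Filter.eventually_all.2 this] with t ht z hz i
  exact ht i z hz

theorem eventually_ray_mem {x ε p η : Fin N → ℤ} (hε : IsDir ε) (hη : IsDir η)
    (h : ∃ᶠ t in Filter.atTop, ray x ε t ∈ cone p η)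
    {y : Fin N → ℤ} (hy : ∀ i, ε i = 0 → y i = x i) :
    ∀ᶠ t in Filter.atTop, ray y ε t ∈ cone p η := by
  obtain ⟨h1, h2⟩ := ray_frequently_cone hε hη h
  filter_upwards [eventually_cone_ray_subset hε h1 h2 hy] with t ht
  exact ht (self_mem_cone _ _)

theorem frequently_mem_biUnion {ι : Type*} {F : Set ι} (hF : F.Finite) {P : ℕ → Prop}
    {Q : ι → ℕ → Prop} (h : ∃ᶠ t in Filter.atTop, P t) (hPQ : ∀ t, P t → ∃ q ∈ F, Q q t) :
    ∃ q ∈ F, ∃ᶠ t in Filter.atTop, P t ∧ Q q t := by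
  by_contra! hc
  refine h ?_
  have : ∀ᶠ t in Filter.atTop, ∀ q ∈ F, ¬ (P t ∧ Q q t) :=
    (Filter.eventually_all_finite hF).2 fun q hq => (hc q hq).mono fun t h hh => h hh.1 hh.2
  filter_upwards [this] with t ht hP
  obtain ⟨q, hq, hQ⟩ := hPQ t hP
  exact ht q hq ⟨hP, hQ⟩

section PeiPerm

variable {S : Set (Fin N → ℤ)} {g : Equiv.Perm (Fin N → ℤ)}

theorem IsPeiPerm.exists_cones (hg : IsPeiPerm S g) :
    ∃ F : Set ((Fin N → ℤ) × (Fin N → ℤ)), F.Finite ∧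
      (∀ q ∈ F, IsDir q.2 ∧ IsometricOn g (cone q.1 q.2)) ∧
      ∀ x, x ∈ S ↔ ∃ q ∈ F, x ∈ cone q.1 q.2 := by
  obtain ⟨⟨𝓛, hfin, horth, hS, -, hiso⟩, -⟩ := hg
  have : ∀ L : Set (Fin N → ℤ), ∃ q : (Fin N → ℤ) × (Fin N → ℤ), L ∈ 𝓛 →
      IsDir q.2 ∧ L = cone q.1 q.2 := by
    intro L
    by_cases hL : L ∈ 𝓛
    · obtain ⟨p, ε, h⟩ := isOrthant_iff.1 (horth L hL)
      exact ⟨(p, ε), fun _ => h⟩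
    · exact ⟨0, fun h => absurd h hL⟩
  choose f hf using this
  refine ⟨f '' 𝓛, hfin.image f, ?_, ?_⟩
  · rintro _ ⟨L, hL, rfl⟩
    obtain ⟨h1, h2⟩ := hf L hL
    exact ⟨h1, h2 ▸ hiso L hL⟩
  · intro x
    rw [hS]
    constructor
    · rintro ⟨L, hL, hx⟩
      exact ⟨f L, ⟨L, hL, rfl⟩, (hf L hL).2 ▸ hx⟩
    · rintro ⟨_, ⟨L, hL, rfl⟩, hx⟩
      exact ⟨L, hL, (hf L hL).2.symm ▸ hx⟩

theorem IsPeiPerm.mem_of_ne (hg : IsPeiPerm S g) {x : Fin N → ℤ} (h : g x ≠ x) : x ∈ S := by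
  by_contra hx
  exact h (hg.2 x hx)

theorem IsPeiPerm.mapsTo (hg : IsPeiPerm S g) {x : Fin N → ℤ} : g x ∈ S ↔ x ∈ S := by
  constructor
  · intro h
    by_contra hx
    rw [hg.2 x hx] at h
    exact hx h
  · intro hx
    by_contra h
    have := g.injective (hg.2 _ h)
    rw [this] at h
    exact h hx

/-- Along each ray, and along all rays representing the same germ, a pei-permutation is
eventually given by a single isometry. -/
theorem IsPeiPerm.exists_affine (hg : IsPeiPerm S g) (x : Fin N → ℤ) {ε : Fin N → ℤ}
    (hε : IsDir ε) :
    ∃ (a : Fin N → ℤ) (A : Matrix (Fin N) (Fin N) ℤ), IsOrthMat A ∧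
      ∀ y, (∀ i, ε i = 0 → y i = x i) →
        ∀ᶠ t in Filter.atTop, g (ray y ε t) = ray (a + A.mulVec y) (A.mulVec ε) t := by
  obtain ⟨F, hF, hF1, hF2⟩ := hg.exists_cones
  by_cases h : ∃ᶠ t in Filter.atTop, ray x ε t ∈ S
  · obtain ⟨q, hq, hfr⟩ := frequently_mem_biUnion hF h fun t ht => (hF2 _).1 ht
    obtain ⟨hd, a, A, hA, hgA⟩ := hF1 q hq
    refine ⟨a, A, hA, fun y hy => ?_⟩
    filter_upwards [eventually_ray_mem hε hd (hfr.mono fun t ht => ht.2) hy] with t ht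
    rw [hgA _ ht, mulVec_ray]
  · refine ⟨0, 1, isOrthMat_one, fun y hy => ?_⟩
    have : ¬ ∃ᶠ t in Filter.atTop, ray y ε t ∈ S := by
      intro h'
      obtain ⟨q, hq, hfr⟩ := frequently_mem_biUnion hF h' fun t ht => (hF2 _).1 ht
      have := eventually_ray_mem hε (hF1 q hq).1 (hfr.mono fun t ht => ht.2)
        (y := x) (fun i hi => (hy i hi).symm)
      exact h (this.mono fun t ht => (hF2 _).2 ⟨q, hq, ht⟩).frequently
    filter_upwards [Filter.not_frequently.1 this] with t ht
    rw [hg.2 _ ht]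
    simp

theorem IsPeiPerm.eventually_cone_subset (hg : IsPeiPerm S g) {x ε : Fin N → ℤ} (hε : IsDir ε)
    (h : ∃ᶠ t in Filter.atTop, ray x ε t ∈ S) {y : Fin N → ℤ} (hy : ∀ i, ε i = 0 → y i = x i) :
    ∀ᶠ t in Filter.atTop, cone (ray y ε t) ε ⊆ S := by
  obtain ⟨F, hF, hF1, hF2⟩ := hg.exists_cones
  obtain ⟨q, hq, hfr⟩ := frequently_mem_biUnion hF h fun t ht => (hF2 _).1 ht
  obtain ⟨h1, h2⟩ := ray_frequently_cone hε (hF1 q hq).1 (hfr.mono fun t ht => ht.2)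
  filter_upwards [eventually_cone_ray_subset hε h1 h2 hy] with t ht z hz
  exact (hF2 z).2 ⟨q, hq, ht hz⟩

/-- `g` moves some germ of rank at least `k`. -/
def MovesRank (k : ℕ) (g : Equiv.Perm (Fin N → ℤ)) : Prop :=
  ∃ x ε, IsDir ε ∧ k ≤ dirRank ε ∧ ∃ᶠ t in Filter.atTop, g (ray x ε t) ≠ ray x ε t

theorem frequently_moves_of_ne {p η y : Fin N → ℤ} (hiso : IsometricOn g (cone p η))
    (hy : y ∈ cone p η) (hne : g y ≠ y) :
    ∃ᶠ t in Filter.atTop, g (ray y η t) ≠ ray y η t := by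
  obtain ⟨a, A, hA, h⟩ := hiso
  intro hc
  refine hne ?_
  have : ∀ᶠ t in Filter.atTop, ray (a + A.mulVec y) (A.mulVec η) t = ray y η t := by
    filter_upwards [hc] with t ht
    rw [← mulVec_ray, ← h _ (ray_mem_cone hy t)]
    exact not_not.1 ht
  rw [h y hy, (ray_eventually_inj this).1]

theorem IsPeiPerm.exists_finite_cover (hg : IsPeiPerm S g) {k : ℕ} (hk : ¬ MovesRank (k + 1) g) :
    ∃ F : Set ((Fin N → ℤ) × (Fin N → ℤ)), F.Finite ∧ ∀ x ε, IsDir ε → k ≤ dirRank ε →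
      (∃ᶠ t in Filter.atTop, g (ray x ε t) ≠ ray x ε t) →
      ∃ q ∈ F, q.2 = ε ∧ ∀ i, ε i = 0 → x i = q.1 i := by
  obtain ⟨F, hF, hF1, hF2⟩ := hg.exists_cones
  refine ⟨F, hF, fun x ε hε hkε hfr => ?_⟩
  obtain ⟨q, hq, hfr'⟩ := frequently_mem_biUnion hF hfr
    fun t ht => (hF2 _).1 (hg.mem_of_ne ht)
  obtain ⟨h1, h2⟩ := ray_frequently_cone hε (hF1 q hq).1 (hfr'.mono fun t ht => ht.2)
  obtain ⟨t, ht1, ht2⟩ := hfr'.exists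
  have hle : dirRank q.2 ≤ k := by
    by_contra! hlt
    exact hk ⟨_, q.2, (hF1 q hq).1, hlt, frequently_moves_of_ne (hF1 q hq).2 ht2 ht1⟩
  have heq := eq_of_match_of_dirRank_le h1 (hle.trans hkε)
  exact ⟨q, hq, heq, fun i hi => (h2 i hi).1 (heq ▸ hi)⟩

theorem dirRank_le (ε : Fin N → ℤ) : dirRank ε ≤ N :=
  (Finset.card_le_univ _).trans_eq (Fintype.card_fin N)

theorem IsPeiPerm.rankLE_iff (hg : IsPeiPerm S g) (k : ℕ) :
    rankLE g k ↔ ¬ MovesRank (k + 1) g := by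
  constructor
  · rintro ⟨T, ⟨𝓛, hfin, horth, hT⟩, hrk, hfix⟩ ⟨x, ε, hε, hk, hfr⟩
    obtain ⟨L, hL, hfr'⟩ := frequently_mem_biUnion (Q := fun L t => ray x ε t ∈ L) hfin hfr
      fun t ht => by
        have : ray x ε t ∈ T := by
          by_contra hx
          exact ht (hfix _ hx)
        rw [hT] at this
        exact this
    obtain ⟨p, η, hη, rfl⟩ := isOrthant_iff.1 (horth L hL)
    obtain ⟨h1, -⟩ := ray_frequently_cone hε hη (hfr'.mono fun t ht => ht.2)
    have hbdd : BddAbove {k | ∃ L, IsOrthantOfRank L k ∧ L ⊆ T} := by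
      refine ⟨N, ?_⟩
      rintro _ ⟨L, hL, -⟩
      obtain ⟨p, ε, -, rfl, -⟩ := isOrthantOfRank_iff.1 hL
      exact dirRank_le ε
    have hmem : dirRank η ∈ {k | ∃ L, IsOrthantOfRank L k ∧ L ⊆ T} :=
      ⟨_, isOrthantOfRank_iff.2 ⟨p, η, hη, rfl, rfl⟩, hT ▸ Set.subset_sUnion_of_mem hL⟩
    have h2 : dirRank η ≤ orthRank T := le_csSup hbdd hmem
    have h3 := dirRank_le_of_match h1
    omega
  · intro hk
    obtain ⟨F, hF, hF1, hF2⟩ := hg.exists_cones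
    refine ⟨⋃₀ ((fun q => cone q.1 q.2) '' {q ∈ F | dirRank q.2 ≤ k}),
      ⟨_, (hF.sep _).image _, ?_, rfl⟩, ?_, ?_⟩
    · rintro _ ⟨q, hq, rfl⟩
      exact isOrthant_iff.2 ⟨q.1, q.2, (hF1 q hq.1).1, rfl⟩
    · refine csSup_le' ?_
      rintro _ ⟨L, hL, hLT⟩
      obtain ⟨p, ε, hε, rfl, rfl⟩ := isOrthantOfRank_iff.1 hL
      obtain ⟨q, hq, hfr⟩ := frequently_mem_biUnion (P := fun _ => True)
        (Q := fun q t => ray p ε t ∈ cone q.1 q.2) (hF.sep fun q => dirRank q.2 ≤ k)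
        (Filter.Eventually.of_forall fun _ => trivial).frequently
        fun t _ => by
          obtain ⟨_, ⟨q, hq, rfl⟩, h⟩ := hLT (ray_mem_cone (self_mem_cone p ε) t)
          exact ⟨q, hq, h⟩
      obtain ⟨h1, -⟩ := ray_frequently_cone hε (hF1 q hq.1).1 (hfr.mono fun t ht => ht.2)
      exact (dirRank_le_of_match h1).trans hq.2
    · intro x hx
      by_contra hne
      obtain ⟨q, hq, hxq⟩ := (hF2 x).1 (hg.mem_of_ne hne)
      have : k < dirRank q.2 := by
        by_contra! hle
        exact hx ⟨_, ⟨q, ⟨hq, hle⟩, rfl⟩, hxq⟩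
      exact hk ⟨x, q.2, (hF1 q hq).1, this, frequently_moves_of_ne (hF1 q hq).2 hxq hne⟩

end PeiPerm

theorem mem_cone_update {p ε x : Fin N → ℤ} {i : Fin N} {v : ℤ} (hv : 0 ≤ ε i * (v - p i))
    (h0 : ε i ≠ 0) :
    x ∈ cone (Function.update p i v) (Function.update ε i 0) ↔ x ∈ cone p ε ∧ x i = v := by
  constructor
  · intro h
    have hi : x i = v := by simpa using (h i).1 (by simp)
    refine ⟨fun j => ?_, hi⟩
    by_cases hj : j = i
    · subst hj
      exact ⟨fun h => absurd h h0, hi ▸ hv⟩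
    · simpa [hj] using h j
  · rintro ⟨h, hi⟩ j
    by_cases hj : j = i
    · subst hj
      simp [hi]
    · simpa [hj] using h j

theorem IsDir.update {ε : Fin N → ℤ} (hε : IsDir ε) (i : Fin N) :
    IsDir (Function.update ε i 0) := by
  intro j
  by_cases hj : j = i
  · simp [hj]
  · simpa [hj] using hε j

section Pieces

variable {f f' : (Fin N → ℤ) → Fin N → ℤ} {X Y L M : Set (Fin N → ℤ)}

theorem IsometricOn.mono (h : IsometricOn f L) (hM : M ⊆ L) : IsometricOn f M := by
  obtain ⟨a, A, hA, hf⟩ := h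
  exact ⟨a, A, hA, fun x hx => hf x (hM hx)⟩

theorem isPeiMapOn_empty : IsPeiMapOn ∅ f :=
  ⟨∅, Set.finite_empty, by simp, by simp, by simp, by simp⟩

theorem isPeiMapOn_cone {p ε : Fin N → ℤ} (hε : IsDir ε) (h : IsometricOn f (cone p ε)) :
    IsPeiMapOn (cone p ε) f :=
  ⟨{cone p ε}, Set.finite_singleton _, by simpa using isOrthant_iff.2 ⟨p, ε, hε, rfl⟩,
    by simp, by simp, by simpa using h⟩

theorem IsPeiMapOn.congr (h : IsPeiMapOn X f) (hf : ∀ x ∈ X, f' x = f x) : IsPeiMapOn X f' := by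
  obtain ⟨𝓛, h1, h2, h3, h4, h5⟩ := h
  refine ⟨𝓛, h1, h2, h3, h4, fun L hL => ?_⟩
  obtain ⟨a, A, hA, hfA⟩ := h5 L hL
  refine ⟨a, A, hA, fun x hx => ?_⟩
  rw [hf x (h3 ▸ ⟨L, hL, hx⟩), hfA x hx]

theorem IsPeiMapOn.union (hX : IsPeiMapOn X f) (hY : IsPeiMapOn Y f) (hXY : Disjoint X Y) :
    IsPeiMapOn (X ∪ Y) f := by
  obtain ⟨𝓛, h1, h2, rfl, h4, h5⟩ := hX
  obtain ⟨𝓜, g1, g2, rfl, g4, g5⟩ := hY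
  refine ⟨𝓛 ∪ 𝓜, h1.union g1, ?_, (Set.sUnion_union _ _).symm, ?_, ?_⟩
  · rintro L (hL | hL)
    exacts [h2 L hL, g2 L hL]
  · refine Set.pairwiseDisjoint_union.2 ⟨h4, g4, fun L hL M hM _ => ?_⟩
    exact hXY.mono (Set.subset_sUnion_of_mem hL) (Set.subset_sUnion_of_mem hM)
  · rintro L (hL | hL)
    exacts [h5 L hL, g5 L hL]

theorem isPeiMapOn_biUnion {ι : Type*} {F : Set ι} (hF : F.Finite) {X : ι → Set (Fin N → ℤ)}
    (hX : ∀ i ∈ F, IsPeiMapOn (X i) f) (hd : F.PairwiseDisjoint X) :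
    IsPeiMapOn (⋃ i ∈ F, X i) f := by
  induction F, hF using Set.Finite.induction_on with
  | empty => simpa using isPeiMapOn_empty
  | @insert i F hi _ ih =>
    rw [Set.biUnion_insert]
    refine (hX i (Set.mem_insert _ _)).union (ih (fun j hj => hX j (Set.mem_insert_of_mem _ hj))
      (hd.subset (Set.subset_insert _ _))) ?_
    rw [Set.disjoint_iUnion₂_right]
    intro j hj
    exact hd (Set.mem_insert _ _) (Set.mem_insert_of_mem _ hj) (by rintro rfl; exact hi hj)

theorem isPeiMapOn_cone_inter {p ε : Fin N → ℤ} (hε : IsDir ε) (h : IsometricOn f (cone p ε))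
    (i : Fin N) {s : ℤ} (hs : s = 1 ∨ s = -1) (c : ℤ) :
    IsPeiMapOn (cone p ε ∩ {x | s * x i ≤ c}) f := by
  by_cases h0 : ε i = 0
  · by_cases hc : s * p i ≤ c
    · convert isPeiMapOn_cone hε h using 1
      refine Set.inter_eq_left.2 fun x hx => ?_
      simpa [(hx i).1 h0] using hc
    · convert isPeiMapOn_empty using 1
      ext x
      simp only [Set.mem_inter_iff, Set.mem_ofPred_eq, Set.mem_empty_iff_false, iff_false, not_and]
      intro hx
      rwa [(hx i).1 h0]
  by_cases h1 : s * ε i = 1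
  · have hV : {v | 0 ≤ ε i * (v - p i) ∧ s * v ≤ c}.Finite := by
      refine (Set.finite_Icc (-|c| - |p i|) (|c| + |p i|)).subset ?_
      rintro v ⟨hv1, hv2⟩
      rcases hs with rfl | rfl <;> rcases hε i with e | e | e <;> simp only [e] at * <;>
        simp only [Set.mem_Icc] <;> grind
    convert isPeiMapOn_biUnion (f := f) (X := fun v => cone (Function.update p i v)
      (Function.update ε i 0)) hV ?_ ?_ using 1
    · ext x
      simp only [Set.mem_inter_iff, Set.mem_iUnion, Set.mem_ofPred_eq, exists_prop]
      constructor
      · rintro ⟨hx, hc⟩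
        exact ⟨x i, ⟨(hx i).2, hc⟩, (mem_cone_update (hx i).2 h0).2 ⟨hx, rfl⟩⟩
      · rintro ⟨v, ⟨hv1, hv2⟩, hx⟩
        obtain ⟨hx', rfl⟩ := (mem_cone_update hv1 h0).1 hx
        exact ⟨hx', hv2⟩
    · rintro v ⟨hv, -⟩
      exact isPeiMapOn_cone (hε.update i)
        (h.mono fun x hx => ((mem_cone_update hv h0).1 hx).1)
    · rintro v ⟨hv, -⟩ v' ⟨hv', -⟩ hne
      refine Set.disjoint_left.2 fun x hx hx' => hne ?_
      rw [← ((mem_cone_update hv h0).1 hx).2, ← ((mem_cone_update hv' h0).1 hx').2]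
  · have h2 : ε i = - s := by
      rcases hs with rfl | rfl <;> rcases hε i with e | e | e <;> simp [e] at *
    have hss : s * s = 1 := by rcases hs with rfl | rfl <;> rfl
    by_cases hc : s * p i ≤ c
    · convert isPeiMapOn_cone hε h using 1
      refine Set.inter_eq_left.2 fun x hx => ?_
      have := (hx i).2
      rw [h2] at this
      simp only [Set.mem_ofPred_eq]
      linarith [mul_sub s (x i) (p i)]
    · have key : cone p ε ∩ {x | s * x i ≤ c} = cone (Function.update p i (s * c)) ε := by
        ext x
        simp only [Set.mem_inter_iff, Set.mem_ofPred_eq]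
        constructor
        · rintro ⟨hx, hxc⟩ j
          by_cases hj : j = i
          · subst hj
            refine ⟨fun h => absurd h h0, ?_⟩
            rw [Function.update_self, h2]
            linarith [mul_sub s (x j) (s * c), mul_assoc s s c, congrArg (· * c) hss]
          · simpa [hj] using hx j
        · intro hx
          have hxi := (hx i).2
          rw [Function.update_self, h2] at hxi
          have hxc : s * x i ≤ c := by
            linarith [mul_sub s (x i) (s * c), mul_assoc s s c, congrArg (· * c) hss]
          refine ⟨fun j => ?_, hxc⟩
          by_cases hj : j = i
          · subst hj
            refine ⟨fun h => absurd h h0, ?_⟩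
            rw [h2]
            linarith [mul_sub s (x j) (p j)]
          · simpa [hj] using hx j
      rw [key]
      exact isPeiMapOn_cone hε (h.mono (key ▸ Set.inter_subset_left))

theorem IsPeiMapOn.inter_halfSpace (h : IsPeiMapOn X f) (i : Fin N) {s : ℤ}
    (hs : s = 1 ∨ s = -1) (c : ℤ) : IsPeiMapOn (X ∩ {x | s * x i ≤ c}) f := by
  obtain ⟨𝓛, h1, h2, rfl, h4, h5⟩ := h
  rw [Set.sUnion_eq_biUnion, Set.iUnion₂_inter]
  refine isPeiMapOn_biUnion h1 (fun L hL => ?_) fun L hL M hM hne =>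
    (h4 hL hM hne).mono Set.inter_subset_left Set.inter_subset_left
  obtain ⟨p, ε, hε, rfl⟩ := isOrthant_iff.1 (h2 L hL)
  exact isPeiMapOn_cone_inter hε (h5 _ hL) i hs c

/-- Cutting along `H` preserves the domains of pei-maps. -/
def Cuts (H : Set (Fin N → ℤ)) : Prop :=
  ∀ (X : Set (Fin N → ℤ)) (f : (Fin N → ℤ) → Fin N → ℤ), IsPeiMapOn X f →
    IsPeiMapOn (X ∩ H) f ∧ IsPeiMapOn (X ∩ Hᶜ) f

theorem cuts_halfSpace (i : Fin N) {s : ℤ} (hs : s = 1 ∨ s = -1) (c : ℤ) :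
    Cuts {x | s * x i ≤ c} := by
  refine fun X f h => ⟨h.inter_halfSpace i hs c, ?_⟩
  convert h.inter_halfSpace i (s := -s) (by rcases hs with rfl | rfl <;> simp) (-c - 1) using 2
  ext x
  simp only [Set.mem_compl_iff, Set.mem_ofPred_eq, neg_mul]
  omega

theorem cuts_univ : Cuts (Set.univ : Set (Fin N → ℤ)) :=
  fun X f h => ⟨by simpa using h, by simpa using isPeiMapOn_empty⟩

theorem Cuts.inter {H K : Set (Fin N → ℤ)} (hH : Cuts H) (hK : Cuts K) : Cuts (H ∩ K) := by
  intro X f h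
  obtain ⟨h1, h2⟩ := hH X f h
  obtain ⟨h3, h4⟩ := hK _ f h1
  refine ⟨by rwa [← Set.inter_assoc], ?_⟩
  convert h2.union h4 ?_ using 1
  · ext x
    simp only [Set.mem_inter_iff, Set.mem_compl_iff, Set.mem_union]
    tauto
  · refine Set.disjoint_left.2 fun x hx hx' => hx.2 hx'.1.2

theorem cuts_cone {p ε : Fin N → ℤ} (hε : IsDir ε) : Cuts (cone p ε) := by
  have key : ∀ i, Cuts {x : Fin N → ℤ | (ε i = 0 → x i = p i) ∧ 0 ≤ ε i * (x i - p i)} := by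
    intro i
    rcases hε i with e | e | e
    · convert cuts_halfSpace i (s := 1) (by simp) (p i) using 2
      ext x
      simp only [e]
      grind
    · convert (cuts_halfSpace i (s := 1) (by simp) (p i)).inter
        (cuts_halfSpace i (s := -1) (by simp) (-p i)) using 1
      ext x
      simp only [e, Set.mem_inter_iff, Set.mem_ofPred_eq]
      grind
    · convert cuts_halfSpace i (s := -1) (by simp) (-p i) using 2
      ext x
      simp only [e]
      grind
  have : ∀ F : Finset (Fin N), Cuts
      {x : Fin N → ℤ | ∀ i ∈ F, (ε i = 0 → x i = p i) ∧ 0 ≤ ε i * (x i - p i)} := by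
    intro F
    induction F using Finset.induction_on with
    | empty => simpa using cuts_univ
    | insert i F _ ih =>
      convert (key i).inter ih using 1
      ext x
      simp
  simpa [cone] using this Finset.univ

end Pieces

/-- Two disjoint isometric orthants in `S` can be swapped by a pei-permutation. -/
theorem exists_swap {S : Set (Fin N → ℤ)} (hS : IsPeiMapOn S id) {a p ε : Fin N → ℤ}
    {A : Matrix (Fin N) (Fin N) ℤ} (hA : IsOrthMat A) (hε : IsDir ε) (h1 : cone p ε ⊆ S)
    (h2 : cone (a + A.mulVec p) (A.mulVec ε) ⊆ S)
    (hd : Disjoint (cone p ε) (cone (a + A.mulVec p) (A.mulVec ε))) :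
    ∃ w : Equiv.Perm (Fin N → ℤ), IsPeiPerm S w ∧ (∀ x, w (w x) = x) ∧
      (∀ x ∈ cone p ε, w x = a + A.mulVec x) ∧
      (∀ x ∈ cone (a + A.mulVec p) (A.mulVec ε),
        w x = -A.transpose.mulVec a + A.transpose.mulVec x) ∧
      ∀ x, x ∉ cone p ε → x ∉ cone (a + A.mulVec p) (A.mulVec ε) → w x = x := by
  classical
  set O := cone p ε with hO
  set D := cone (a + A.mulVec p) (A.mulVec ε) with hD
  let f : (Fin N → ℤ) → Fin N → ℤ := fun x =>
    if x ∈ O then a + A.mulVec x else if x ∈ D then -A.transpose.mulVec a + A.transpose.mulVec x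
    else x
  have fO : ∀ x ∈ O, f x = a + A.mulVec x := fun x hx => if_pos hx
  have fD : ∀ x ∈ D, f x = -A.transpose.mulVec a + A.transpose.mulVec x := fun x hx => by
    have : x ∉ O := fun h => Set.disjoint_left.1 hd h hx
    simp only [f, if_neg this, if_pos hx]
  have fE : ∀ x, x ∉ O → x ∉ D → f x = x := fun x hx hx' => by
    simp only [f, if_neg hx, if_neg hx']
  have hOD : ∀ x ∈ O, a + A.mulVec x ∈ D := fun x hx => mulVec_mem_cone hA hx
  have hfD : ∀ x ∈ O, f (a + A.mulVec x) = x := fun x hx => by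
    rw [fD _ (hOD x hx), Matrix.mulVec_add, Matrix.mulVec_mulVec, hA.transpose_mul,
      Matrix.one_mulVec, neg_add_cancel_left]
  have hinv : Function.Involutive f := by
    intro x
    by_cases hx : x ∈ O
    · rw [fO x hx, hfD x hx]
    by_cases hx' : x ∈ D
    · rw [hD, ← image_cone hA] at hx'
      obtain ⟨y, hy, rfl⟩ := hx'
      simp only
      rw [hfD y hy, fO y hy]
    · rw [fE x hx hx', fE x hx hx']
  refine ⟨hinv.toPerm f, ⟨?_, ?_⟩, hinv, fO, fD, fE⟩
  · have e1 : IsPeiMapOn O f := isPeiMapOn_cone hε ⟨a, A, hA, fO⟩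
    have e2 : IsPeiMapOn D f := isPeiMapOn_cone (hε.mulVec hA) ⟨_, _, hA.transpose, fD⟩
    have e3 : IsPeiMapOn (S ∩ Oᶜ ∩ Dᶜ) f :=
      (((cuts_cone (hε.mulVec hA)) _ _ ((cuts_cone hε) _ _ hS).2).2).congr
        fun x hx => fE x hx.1.2 hx.2
    have := (e1.union e2 hd).union e3 (Set.disjoint_left.2 fun x hx hx' => ?_)
    · have hSe : S = O ∪ D ∪ S ∩ Oᶜ ∩ Dᶜ := by
        ext x
        simp only [Set.mem_union, Set.mem_inter_iff, Set.mem_compl_iff]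
        constructor
        · tauto
        · rintro ((h | h) | h)
          exacts [h1 h, h2 h, h.1.1]
      rw [hSe]
      exact this
    · rcases hx with hx | hx
      exacts [hx'.1.2 hx, hx'.2 hx]
  · intro x hx
    exact fE x (fun h => hx (h1 h)) fun h => hx (h2 h)

theorem IsPeiPerm.isPeiMapOn_id {S : Set (Fin N → ℤ)} (h : IsPeiPerm S 1) : IsPeiMapOn S id := h.1

theorem cone_zero (p : Fin N → ℤ) : cone p 0 = {p} := by
  ext x
  simp [cone, funext_iff]

theorem isPeiPerm_swap {S : Set (Fin N → ℤ)} (hS : IsPeiMapOn S id) {x y : Fin N → ℤ}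
    (hx : x ∈ S) (hy : y ∈ S) : IsPeiPerm S (Equiv.swap x y) := by
  by_cases hxy : x = y
  · subst hxy
    rw [Equiv.swap_self]
    exact ⟨hS, fun _ _ => rfl⟩
  obtain ⟨w, hw, hww, h1, -, h3⟩ := exists_swap hS (a := y - x) (p := x) (ε := 0)
    isOrthMat_one (fun i => by simp) (by simpa [cone_zero] using hx)
    (by simpa [cone_zero] using hy) (by simpa [cone_zero] using hxy)
  have e1 : w x = y := by simpa using h1 x (self_mem_cone _ _)
  convert hw
  ext1 z
  by_cases hz : z = x
  · rw [hz, e1, Equiv.swap_apply_left]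
  by_cases hz' : z = y
  · rw [hz', ← e1, hww, e1, Equiv.swap_apply_right]
  · rw [Equiv.swap_apply_of_ne_of_ne hz hz', h3 z] <;> simpa [cone_zero]

theorem mulVec_agree {A : Matrix (Fin N) (Fin N) ℤ} (hA : IsOrthMat A) {ε x y : Fin N → ℤ}
    (h : ∀ i, ε i = 0 → x i = y i) (i : Fin N) (hi : A.mulVec ε i = 0) :
    A.mulVec x i = A.mulVec y i := by
  obtain ⟨σ, s, hs, hv⟩ := orthMat_signed hA
  rw [hv] at hi ⊢
  rw [hv, h]
  rcases hs i with h | h <;> simpa [h] using hi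

theorem exists_orthMat_mulVec_eq {ε δ : Fin N → ℤ} (hε : IsDir ε) (hδ : IsDir δ)
    (h : dirRank ε = dirRank δ) : ∃ A, IsOrthMat A ∧ A.mulVec ε = δ := by
  classical
  have hc : Fintype.card {i // δ i ≠ 0} = Fintype.card {i // ε i ≠ 0} := by
    rw [Fintype.card_subtype, Fintype.card_subtype]
    exact h.symm
  let e : {i // δ i ≠ 0} ≃ {i // ε i ≠ 0} := Fintype.equivOfCardEq hc
  let σ : Equiv.Perm (Fin N) := e.extendSubtype
  have h1 : ∀ i, δ i ≠ 0 → ε (σ i) ≠ 0 := fun i hi => e.extendSubtype_mem i hi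
  have h2 : ∀ i, δ i = 0 → ε (σ i) = 0 := fun i hi =>
    not_not.1 (e.extendSubtype_not_mem i (not_not.2 hi))
  obtain ⟨A, hA, hv⟩ := exists_orthMat_of_signed σ
    (fun i => if δ i = 0 then 1 else δ i * ε (σ i)) (by
      intro i
      by_cases hi : δ i = 0
      · simp [hi]
      · have := h1 i hi
        rcases hδ i with a | a | a <;> rcases hε (σ i) with b | b | b <;> simp_all)
  refine ⟨A, hA, ?_⟩
  ext i
  rw [hv]
  by_cases hi : δ i = 0
  · simp [hi, h2 i hi]
  · have := h1 i hi
    rcases hδ i with a | a | a <;> rcases hε (σ i) with b | b | b <;> simp_all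

/-- The pair `(x, ε)` with the coordinates of `x` along `ε` forgotten: two rays represent the
same germ if and only if they have the same key. -/
def germKey (q : (Fin N → ℤ) × (Fin N → ℤ)) : (Fin N → ℤ) × (Fin N → ℤ) :=
  (fun i => if q.2 i = 0 then q.1 i else 0, q.2)

theorem germKey_eq_iff {q r : (Fin N → ℤ) × (Fin N → ℤ)} :
    germKey q = germKey r ↔ q.2 = r.2 ∧ ∀ i, q.2 i = 0 → q.1 i = r.1 i := by
  constructor
  · intro h
    have h2 : q.2 = r.2 := (Prod.ext_iff.1 h).2
    refine ⟨h2, fun i hi => ?_⟩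
    have := congrFun (Prod.ext_iff.1 h).1 i
    simpa [germKey, hi, ← h2] using this
  · rintro ⟨h1, h2⟩
    refine Prod.ext (funext fun i => ?_) h1
    by_cases hi : q.2 i = 0
    · simp [germKey, hi, h2 i hi, ← h1]
    · simp [germKey, hi, ← h1]

theorem eventually_disjoint_cone {x ε y δ : Fin N → ℤ} (hε : IsDir ε) (hδ : IsDir δ)
    (h : germKey (x, ε) ≠ germKey (y, δ)) :
    ∀ᶠ t in Filter.atTop, Disjoint (cone (ray x ε t) ε) (cone (ray y δ t) δ) := by
  by_cases hεδ : ε = δ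
  · subst hεδ
    obtain ⟨i, hi, hne⟩ : ∃ i, ε i = 0 ∧ x i ≠ y i := by
      by_contra! hc
      exact h (germKey_eq_iff.2 ⟨rfl, hc⟩)
    refine Filter.Eventually.of_forall fun t => Set.disjoint_left.2 fun z hz hz' => hne ?_
    have e1 := (hz i).1 hi
    have e2 := (hz' i).1 hi
    simp only [ray, hi] at e1 e2
    linarith
  · obtain ⟨i, hi⟩ := Function.ne_iff.1 hεδ
    filter_upwards [Filter.eventually_gt_atTop ((x i).natAbs + (y i).natAbs)] with t ht
    refine Set.disjoint_left.2 fun z hz hz' => ?_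
    obtain ⟨h1, h2⟩ := hz i
    obtain ⟨h3, h4⟩ := hz' i
    simp only [ray] at h1 h2 h3 h4
    rcases hε i with e | e | e <;> rcases hδ i with d | d | d <;>
      simp only [e, d, forall_const] at * <;> omega

theorem germKey_eq_of_frequently_mem_cone {x ε p η : Fin N → ℤ} (hε : IsDir ε) (hη : IsDir η)
    (hr : dirRank η ≤ dirRank ε) (h : ∃ᶠ t in Filter.atTop, ray x ε t ∈ cone p η) :
    germKey (x, ε) = germKey (p, η) := by
  obtain ⟨h1, h2⟩ := ray_frequently_cone hε hη h
  have heq := eq_of_match_of_dirRank_le h1 hr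
  exact germKey_eq_iff.2 ⟨heq.symm, fun i hi => (h2 i hi).1 (heq ▸ hi)⟩

theorem germKey_ray (x ε : Fin N → ℤ) (t : ℕ) : germKey (ray x ε t, ε) = germKey (x, ε) :=
  germKey_eq_iff.2 ⟨rfl, fun i hi => by
    have hi' : ε i = 0 := hi
    simp [ray, hi']⟩

theorem eventually_mem_cone_of_germKey_eq {x ε p : Fin N → ℤ} (hε : IsDir ε)
    (h : germKey (x, ε) = germKey (p, ε)) : ∀ᶠ t in Filter.atTop, ray x ε t ∈ cone p ε := by
  have h2 := (germKey_eq_iff.1 h).2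
  exact eventually_ray_mem hε hε (x := p)
    (Filter.Eventually.of_forall fun t => ray_mem_cone (self_mem_cone p ε) t).frequently h2

/-- Any two distinct germs of the same rank of `S` can be swapped by a pei-permutation fixing all
other germs of this rank. -/
theorem exists_germ_swap {S : Set (Fin N → ℤ)} (hS : IsPeiPerm S 1) {x ε y δ : Fin N → ℤ}
    (hε : IsDir ε) (hδ : IsDir δ) (hr : dirRank ε = dirRank δ)
    (hx : ∀ᶠ t in Filter.atTop, ray x ε t ∈ S) (hy : ∀ᶠ t in Filter.atTop, ray y δ t ∈ S)
    (hne : germKey (x, ε) ≠ germKey (y, δ)) :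
    ∃ w, IsPeiPerm S w ∧
      (∃ x', germKey (x', δ) = germKey (y, δ) ∧
        ∀ᶠ t in Filter.atTop, w (ray x ε t) = ray x' δ t) ∧
      (∃ y', germKey (y', ε) = germKey (x, ε) ∧
        ∀ᶠ t in Filter.atTop, w (ray y δ t) = ray y' ε t) ∧
      ∀ z ζ, IsDir ζ → dirRank ζ = dirRank ε → germKey (z, ζ) ≠ germKey (x, ε) →
        germKey (z, ζ) ≠ germKey (y, δ) →
        ∀ᶠ t in Filter.atTop, w (ray z ζ t) = ray z ζ t := by
  obtain ⟨A, hA, hAε⟩ := exists_orthMat_mulVec_eq hε hδ hr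
  obtain ⟨T, ⟨hT1, hT2⟩, hT3⟩ := (((hS.eventually_cone_subset hε hx.frequently
    (y := x) fun _ _ => rfl).and (hS.eventually_cone_subset hδ hy.frequently
    (y := y) fun _ _ => rfl)).and (eventually_disjoint_cone hε hδ hne)).exists
  set p := ray x ε T with hp
  set q := ray y δ T with hq
  have hq' : q - A.mulVec p + A.mulVec p = q := sub_add_cancel _ _
  have hpx : germKey (p, ε) = germKey (x, ε) := germKey_ray x ε T
  have hqy : germKey (q, δ) = germKey (y, δ) := germKey_ray y δ T
  obtain ⟨w, hw, -, h1, h2, h3⟩ := exists_swap hS.isPeiMapOn_id (a := q - A.mulVec p) (p := p)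
    hA hε hT1 (by rwa [hq', hAε]) (by rwa [hq', hAε])
  rw [hq', hAε] at h2 h3
  have hAδ : A.transpose.mulVec δ = ε := by
    rw [← hAε, Matrix.mulVec_mulVec, hA.transpose_mul, Matrix.one_mulVec]
  refine ⟨w, hw, ⟨q - A.mulVec p + A.mulVec x, germKey_eq_iff.2 ⟨rfl, fun i hi => ?_⟩, ?_⟩,
    ⟨-A.transpose.mulVec (q - A.mulVec p) + A.transpose.mulVec y,
      germKey_eq_iff.2 ⟨rfl, fun i hi => ?_⟩, ?_⟩, ?_⟩
  · have e1 := mulVec_agree hA (germKey_eq_iff.1 hpx).2 i (by rw [hAε]; exact hi)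
    have e2 := (germKey_eq_iff.1 hqy).2 i hi
    simp only [Pi.add_apply, Pi.sub_apply] at e1 e2 ⊢
    linarith
  · filter_upwards [eventually_mem_cone_of_germKey_eq hε hpx.symm] with t ht
    rw [h1 _ ht, mulVec_ray, hAε]
  · have e1 := mulVec_agree hA.transpose (germKey_eq_iff.1 hqy).2 i (by rw [hAδ]; exact hi)
    have e2 := (germKey_eq_iff.1 hpx).2 i hi
    simp only [Matrix.mulVec_sub, Matrix.mulVec_mulVec, hA.transpose_mul, Matrix.one_mulVec,
      Pi.add_apply, Pi.sub_apply, Pi.neg_apply] at e1 e2 ⊢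
    linarith
  · filter_upwards [eventually_mem_cone_of_germKey_eq hδ hqy.symm] with t ht
    rw [h2 _ ht, mulVec_ray, hAδ]
  · intro z ζ hζ hrz hzx hzy
    have n1 : ¬ ∃ᶠ t in Filter.atTop, ray z ζ t ∈ cone p ε := fun h =>
      hzx ((germKey_eq_of_frequently_mem_cone hζ hε hrz.ge h).trans hpx)
    have n2 : ¬ ∃ᶠ t in Filter.atTop, ray z ζ t ∈ cone q δ := fun h =>
      hzy ((germKey_eq_of_frequently_mem_cone hζ hδ (hr ▸ hrz.ge) h).trans hqy)
    filter_upwards [Filter.not_frequently.1 n1, Filter.not_frequently.1 n2] with t t1 t2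
    exact h3 _ t1 t2

section SwapActions

variable {G X Γ : Type*} [Group G]

/-- `g` fixes every point lying over the complement of `A`. -/
def SuppOver (ρ : G →* Equiv.Perm X) (π : X → Γ) (g : G) (A : Set Γ) : Prop :=
  ∀ z, π z ∉ A → ρ g z = z

/-- The action permutes the fibres of `π`. -/
def PermutesFibres (ρ : G →* Equiv.Perm X) (π : X → Γ) : Prop :=
  ∀ g x y, π x = π y → π (ρ g x) = π (ρ g y)

/-- `w` swaps the fibres of `x` and `y` and is the identity on the other fibres. -/
def SwapsFibres (ρ : G →* Equiv.Perm X) (π : X → Γ) (w : G) (x y : X) : Prop :=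
  π (ρ w x) = π y ∧ π (ρ w y) = π x ∧ ∀ z, π z ≠ π x → π z ≠ π y → ρ w z = z

variable {ρ : G →* Equiv.Perm X} {π : X → Γ} {g w : G} {x y z : X} {A B : Set Γ}

theorem SuppOver.mono (h : SuppOver ρ π g A) (hAB : A ⊆ B) : SuppOver ρ π g B :=
  fun z hz => h z fun h' => hz (hAB h')

theorem map_inv_apply_eq_iff : ρ g⁻¹ x = y ↔ x = ρ g y := by
  rw [map_inv, Equiv.Perm.inv_eq_iff_eq]

theorem SuppOver.inv (h : SuppOver ρ π g A) : SuppOver ρ π g⁻¹ A :=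
  fun z hz => map_inv_apply_eq_iff.2 (h z hz).symm

theorem SwapsFibres.inv_of_ne (h : SwapsFibres ρ π w x y) (h1 : π z ≠ π x) (h2 : π z ≠ π y) :
    ρ w⁻¹ z = z :=
  map_inv_apply_eq_iff.2 (h.2.2 z h1 h2).symm

theorem PermutesFibres.inv_of_eq (hπ : PermutesFibres ρ π) (h : π z = π (ρ w x)) :
    π (ρ w⁻¹ z) = π x := by
  rw [hπ w⁻¹ _ _ h]
  simp

theorem SuppOver.conj_swap (hπ : PermutesFibres ρ π) (hw : SwapsFibres ρ π w x y)
    (hg : SuppOver ρ π g A) (hy : π y ∉ A) :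
    SuppOver ρ π (w * g * w⁻¹) (insert (π y) (A \ {π x})) := by
  intro z hz
  have key : π (ρ w⁻¹ z) ∉ A := by
    simp only [Set.mem_insert_iff, Set.mem_sdiff, Set.mem_singleton_iff, not_or, not_and,
      not_not] at hz
    by_cases hzx : π z = π x
    · rwa [hπ.inv_of_eq (hzx.trans hw.2.1.symm)]
    · rw [hw.inv_of_ne hzx hz.1]
      exact fun h => hzx (hz.2 h)
  simp only [map_mul, Equiv.Perm.mul_apply]
  rw [hg _ key]
  simp

variable (hπ : PermutesFibres ρ π)
  (hswap : ∀ x y, π x ≠ π y → ∃ w, SwapsFibres ρ π w x y)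

include hπ hswap in
theorem mem_of_suppOver_card_le {C C' : Subgroup G} [C.Normal] [C'.Normal] {Γ₀ : Finset Γ}
    (hΓ₀ : (Γ₀ : Set Γ) ⊆ Set.range π) (h : ∀ g ∈ C', SuppOver ρ π g Γ₀ → g ∈ C)
    {A : Finset Γ} (hA : (A : Set Γ) ⊆ Set.range π) (hcard : A.card ≤ Γ₀.card)
    (hg : g ∈ C') (hgA : SuppOver ρ π g A) : g ∈ C := by
  classical
  induction hn : (A \ Γ₀).card generalizing A g with
  | zero =>
    rw [Finset.card_eq_zero, Finset.sdiff_eq_empty_iff_subset] at hn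
    exact h g hg (hgA.mono hn)
  | succ n ih =>
    obtain ⟨a, ha⟩ : (A \ Γ₀).Nonempty := Finset.card_pos.1 (by omega)
    obtain ⟨haA, haΓ⟩ := Finset.mem_sdiff.1 ha
    obtain ⟨b, hb⟩ : (Γ₀ \ A).Nonempty := by
      rw [Finset.nonempty_iff_ne_empty, Ne, Finset.sdiff_eq_empty_iff_subset]
      intro hsub
      exact haΓ (Finset.eq_of_subset_of_card_le hsub hcard ▸ haA)
    obtain ⟨hbΓ, hbA⟩ := Finset.mem_sdiff.1 hb
    obtain ⟨x, rfl⟩ := hA haA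
    obtain ⟨y, rfl⟩ := hΓ₀ hbΓ
    have hne : π x ≠ π y := fun h => hbA (h ▸ haA)
    obtain ⟨w, hw⟩ := hswap x y hne
    have := ih (A := insert (π y) (A.erase (π x))) (g := w * g * w⁻¹) ?_ ?_
      (Subgroup.Normal.conj_mem inferInstance g hg w) ?_ ?_
    · have := Subgroup.Normal.conj_mem inferInstance _ this w⁻¹
      simpa [mul_assoc] using this
    · rw [Finset.coe_insert, Finset.coe_erase]
      exact Set.insert_subset (Set.mem_range_self y) (Set.sdiff_subset.trans hA)
    · refine (Finset.card_insert_le _ _).trans ?_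
      rw [Finset.card_erase_of_mem haA]
      have := Finset.card_pos.2 ⟨_, haA⟩
      omega
    · rw [Finset.coe_insert, Finset.coe_erase]
      exact hgA.conj_swap hπ hw hbA
    · rw [Finset.insert_sdiff_of_mem _ hbΓ, Finset.erase_sdiff_comm, Finset.card_erase_of_mem ha,
        hn, Nat.add_sub_cancel]

include hπ hswap in
/-- An action permuting fibres, with enough fibre swaps, has a finite set of fibres controlling
all finitely supported elements of normal subgroups. -/
theorem exists_finset_control : ∃ Γ₀ : Finset Γ, ∀ C C' : Subgroup G, C.Normal → C'.Normal →
    (∀ g ∈ C', SuppOver ρ π g Γ₀ → g ∈ C) →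
    ∀ g ∈ C', ∀ A : Set Γ, A.Finite → SuppOver ρ π g A → g ∈ C := by
  classical
  by_cases hfin : (Set.range π).Finite
  · refine ⟨hfin.toFinset, fun C C' _ _ h g hg A _ _ => h g hg fun z hz => ?_⟩
    simp at hz
  obtain ⟨_, ⟨x₀, rfl⟩⟩ : (Set.range π).Nonempty := Set.Infinite.nonempty hfin
  obtain ⟨_, ⟨x₁, rfl⟩, h01⟩ := Set.Infinite.exists_notMem_finset hfin {π x₀}
  obtain ⟨_, ⟨x₂, rfl⟩, h2⟩ := Set.Infinite.exists_notMem_finset hfin {π x₀, π x₁}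
  simp only [Finset.mem_singleton] at h01
  simp only [Finset.mem_insert, Finset.mem_singleton, not_or] at h2
  have hcard : ({π x₀, π x₁, π x₂} : Finset Γ).card = 3 :=
    Finset.card_eq_three.2 ⟨_, _, _, Ne.symm h01, Ne.symm h2.1, Ne.symm h2.2, rfl⟩
  refine ⟨{π x₀, π x₁, π x₂}, fun C C' hC hC' h g hg A hA hgA => ?_⟩
  have hsmall : ∀ g ∈ C', ∀ A : Finset Γ, (A : Set Γ) ⊆ Set.range π → A.card ≤ 3 →
      SuppOver ρ π g A → g ∈ C := by
    intro g hg A hA hA3 hgA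
    refine mem_of_suppOver_card_le hπ hswap ?_ h hA (hA3.trans hcard.ge) hg hgA
    intro a ha
    simp only [Finset.coe_insert, Finset.coe_singleton, Set.mem_insert_iff,
      Set.mem_singleton_iff] at ha
    rcases ha with rfl | rfl | rfl <;> exact Set.mem_range_self _
  suffices key : ∀ (n : ℕ) (A : Finset Γ), (A \ {π x₀, π x₁}).card = n →
      (A : Set Γ) ⊆ Set.range π → ∀ g ∈ C', SuppOver ρ π g A → g ∈ C by
    refine key _ (hA.toFinset.filter (· ∈ Set.range π)) rfl ?_ g hg ?_
    · intro a ha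
      exact (Finset.mem_filter.1 ha).2
    · intro z hz
      refine hgA z fun hzA => hz ?_
      simpa using hzA
  clear hgA hA hg A g
  intro n
  induction n with
  | zero =>
    intro A hn hA g hg hgA
    rw [Finset.card_eq_zero, Finset.sdiff_eq_empty_iff_subset] at hn
    exact hsmall g hg A hA ((Finset.card_le_card hn).trans (Finset.card_le_two.trans (by norm_num)))
      hgA
  | succ n ih =>
    intro A hn hA g hg hgA
    obtain ⟨a, ha⟩ : (A \ {π x₀, π x₁}).Nonempty := Finset.card_pos.1 (by omega)
    obtain ⟨haA, ha01⟩ := Finset.mem_sdiff.1 ha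
    by_cases hfix : ∀ z, π z = a → ρ g z = z
    · refine ih (A.erase a) ?_ ?_ g hg ?_
      · rw [Finset.erase_sdiff_comm, Finset.card_erase_of_mem ha, hn, Nat.add_sub_cancel]
      · rw [Finset.coe_erase]
        exact Set.sdiff_subset.trans hA
      · intro z hz
        by_cases hza : π z = a
        · exact hfix z hza
        · exact hgA z (by simpa [hza] using hz)
    push Not at hfix
    obtain ⟨x, rfl, hx⟩ := hfix
    have hbA : π (ρ g x) ∈ A := by
      by_contra hb
      exact hx ((ρ g).injective (hgA _ (by simpa using hb)))
    obtain ⟨e, he, heb⟩ : ∃ e, (π e = π x₀ ∨ π e = π x₁) ∧ π e ≠ π (ρ g x) := by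
      by_cases hb : π x₀ = π (ρ g x)
      · exact ⟨x₁, Or.inr rfl, fun h' => h01 (h'.trans hb.symm)⟩
      · exact ⟨x₀, Or.inl rfl, hb⟩
    simp only [Finset.mem_insert, Finset.mem_singleton, not_or] at ha01
    have hea : π e ≠ π x := by
      rcases he with he | he <;> rw [he]
      exacts [Ne.symm ha01.1, Ne.symm ha01.2]
    obtain ⟨_, ⟨d, rfl⟩, hd⟩ := Set.Infinite.exists_notMem_finset hfin (insert (π e) A)
    simp only [Finset.mem_insert, not_or] at hd
    obtain ⟨hde, hdA⟩ := hd
    have hdx : π d ≠ π x := fun h => hdA (h ▸ haA)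
    have hdb : π d ≠ π (ρ g x) := fun h => hdA (h ▸ hbA)
    obtain ⟨v, hv⟩ := hswap x d hdx.symm
    obtain ⟨w, hw⟩ := hswap d e hde
    set c := g * (v * g⁻¹ * v⁻¹) with hc
    have hcC : c ∈ C' := C'.mul_mem hg (hC'.conj_mem _ (C'.inv_mem hg) v)
    set c' := w * c * w⁻¹ with hc'
    have hcC' : c' ∈ C' := hC'.conj_mem _ hcC w
    have hcz : ∀ z, π z = π x → ρ c z = ρ g z := by
      intro z hz
      have h1 : π (ρ v⁻¹ z) = π d := hπ.inv_of_eq (hz.trans hv.2.1.symm)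
      have h2 : ρ g⁻¹ (ρ v⁻¹ z) = ρ v⁻¹ z := hgA.inv _ (by rw [h1]; simpa using hdA)
      simp only [hc, map_mul, Equiv.Perm.mul_apply]
      rw [h2]
      simp
    have hcz' : ∀ z, π z = π x → ρ c' z = ρ g z := by
      intro z hz
      simp only [hc', map_mul, Equiv.Perm.mul_apply]
      rw [hw.inv_of_ne (hz ▸ hdx.symm) (hz ▸ hea.symm), hcz z hz]
      have := hπ g _ _ hz
      exact hw.2.2 _ (this ▸ hdb.symm) (this ▸ heb.symm)
    have hcsupp : SuppOver ρ π c {π x, π (ρ g x), π d} := by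
      intro z hz
      simp only [Set.mem_insert_iff, Set.mem_singleton_iff, not_or] at hz
      obtain ⟨z1, z2, z3⟩ := hz
      simp only [hc, map_mul, Equiv.Perm.mul_apply]
      rw [hv.inv_of_ne z1 z3, hv.2.2 (ρ g⁻¹ z)]
      · simp
      · intro h
        refine z2 ?_
        rw [← hπ g _ _ h]
        simp
      · intro h
        have h2 : ρ g (ρ g⁻¹ z) = ρ g⁻¹ z := hgA _ (by rw [h]; simpa using hdA)
        rw [← h2] at h
        exact z3 (by simpa using h)
    have hc'supp := hcsupp.conj_swap hπ hw (by simp [hea, heb, Ne.symm hde])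
    have hc'supp' : SuppOver ρ π c' ({π x, π (ρ g x), π e} : Finset Γ) := by
      refine hc'supp.mono fun a ha => ?_
      simp only [Set.mem_insert_iff, Set.mem_sdiff, Set.mem_singleton_iff, Finset.coe_insert,
        Finset.coe_singleton] at ha ⊢
      tauto
    have hc'C : c' ∈ C := by
      refine hsmall c' hcC' _ ?_ Finset.card_le_three hc'supp'
      intro a ha
      simp only [Finset.coe_insert, Finset.coe_singleton, Set.mem_insert_iff,
        Set.mem_singleton_iff] at ha
      rcases ha with rfl | rfl | rfl <;> exact Set.mem_range_self _
    have hrest : c'⁻¹ * g ∈ C := by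
      refine ih ((insert (π e) A).erase (π x)) ?_ ?_ _ (C'.mul_mem (C'.inv_mem hcC') hg) ?_
      · have he' : π e ∈ ({π x₀, π x₁} : Finset Γ) := by simpa using he
        rw [Finset.erase_sdiff_comm, Finset.insert_sdiff_of_mem _ he',
          Finset.card_erase_of_mem ha, hn, Nat.add_sub_cancel]
      · rw [Finset.coe_erase, Finset.coe_insert]
        exact Set.sdiff_subset.trans (Set.insert_subset (Set.mem_range_self e) hA)
      · intro z hz
        simp only [map_mul, Equiv.Perm.mul_apply]
        rw [map_inv_apply_eq_iff]
        by_cases hzx : π z = π x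
        · rw [hcz' z hzx]
        · simp only [Finset.coe_erase, Finset.coe_insert, Set.mem_sdiff, Set.mem_insert_iff,
            Set.mem_singleton_iff, Finset.mem_coe, hzx, not_false_eq_true, and_true, not_or] at hz
          rw [hgA z (by simpa using hz.2), hc'supp' z]
          have : π z ≠ π (ρ g x) := fun h => hz.2 (h ▸ hbA)
          simp [hzx, hz.1, this]
    simpa using C.mul_mem hc'C hrest

end SwapActions

section RayAction

variable {S : Set (Fin N → ℤ)} {G : Subgroup (Equiv.Perm (Fin N → ℤ))} {k : ℕ}

/-- The rays of rank `k` which eventually lie in `S`. -/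
def RankRay (S : Set (Fin N → ℤ)) (k : ℕ) : Type :=
  {q : (Fin N → ℤ) × (Fin N → ℤ) //
    IsDir q.2 ∧ dirRank q.2 = k ∧ ∀ᶠ t in Filter.atTop, ray q.1 q.2 t ∈ S}

/-- The germ represented by a ray. -/
def RankRay.germ (q : RankRay S k) : (Fin N → ℤ) × (Fin N → ℤ) := germKey q.1

/-- `ρ` is the action of `G` on rays up to finite initial segments. -/
def IsRayAction (ρ : G →* Equiv.Perm (RankRay S k)) : Prop :=
  ∀ (g : G) (q : RankRay S k), ∀ᶠ t in Filter.atTop,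
    (g : Equiv.Perm (Fin N → ℤ)) (ray q.1.1 q.1.2 t) = ray (ρ g q).1.1 (ρ g q).1.2 t

theorem RankRay.eq_of_eventually {q r : RankRay S k}
    (h : ∀ᶠ t in Filter.atTop, ray q.1.1 q.1.2 t = ray r.1.1 r.1.2 t) : q = r := by
  obtain ⟨h1, h2⟩ := ray_eventually_inj h
  exact Subtype.ext (Prod.ext h1 h2)

variable (hG : ∀ g ∈ G, IsPeiPerm S g)

include hG in
theorem exists_isRayAction (k : ℕ) : ∃ ρ : G →* Equiv.Perm (RankRay S k), IsRayAction ρ := by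
  have : ∀ (g : G) (q : RankRay S k), ∃ r : RankRay S k, ∀ᶠ t in Filter.atTop,
      (g : Equiv.Perm (Fin N → ℤ)) (ray q.1.1 q.1.2 t) = ray r.1.1 r.1.2 t := by
    intro g q
    obtain ⟨a, A, hA, h⟩ := (hG g g.2).exists_affine q.1.1 q.2.1
    refine ⟨⟨(a + A.mulVec q.1.1, A.mulVec q.1.2), q.2.1.mulVec hA,
      (dirRank_mulVec hA _).trans q.2.2.1, ?_⟩, h _ fun _ _ => rfl⟩
    filter_upwards [h q.1.1 fun _ _ => rfl, q.2.2.2] with t h1 h2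
    rw [← h1]
    exact (hG g g.2).mapsTo.2 h2
  choose f hf using this
  let φ : G →* Function.End (RankRay S k) :=
    { toFun := f
      map_one' := by
        refine funext fun q => ?_
        refine RankRay.eq_of_eventually ?_
        filter_upwards [hf 1 q] with t ht
        rw [← ht]
        rfl
      map_mul' := by
        intro g h
        refine funext fun q => ?_
        refine RankRay.eq_of_eventually ?_
        filter_upwards [hf (g * h) q, hf g (f h q), hf h q] with t h1 h2 h3
        rw [← h1]
        change _ = ray (f g (f h q)).1.1 (f g (f h q)).1.2 t
        rw [← h2, ← h3]
        rfl }
  exact ⟨φ.toHomPerm, hf⟩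

variable {ρ : G →* Equiv.Perm (RankRay S k)} (hρ : IsRayAction ρ)

include hG hρ in
/-- The action on all rays representing a germ is given by a single isometry. -/
theorem IsRayAction.exists_affine (g : G) (q : RankRay S k) :
    ∃ (a : Fin N → ℤ) (A : Matrix (Fin N) (Fin N) ℤ), IsOrthMat A ∧
      ∀ r : RankRay S k, r.germ = q.germ →
        (ρ g r).1 = (a + A.mulVec r.1.1, A.mulVec r.1.2) := by
  obtain ⟨a, A, hA, h⟩ := (hG g g.2).exists_affine q.1.1 q.2.1
  refine ⟨a, A, hA, fun r hr => ?_⟩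
  obtain ⟨h1, h2⟩ := germKey_eq_iff.1 hr
  have := h r.1.1 fun i hi => h2 i (h1 ▸ hi)
  rw [← h1] at this
  have key : ∀ᶠ t in Filter.atTop, ray (ρ g r).1.1 (ρ g r).1.2 t =
      ray (a + A.mulVec r.1.1) (A.mulVec r.1.2) t := by
    filter_upwards [this, hρ g r] with t t1 t2
    rw [← t1, t2]
  obtain ⟨h3, h4⟩ := ray_eventually_inj key
  exact Prod.ext h3 h4

include hG hρ in
theorem IsRayAction.permutesFibres : PermutesFibres ρ RankRay.germ := by
  intro g x y hxy
  obtain ⟨a, A, hA, h⟩ := hρ.exists_affine hG g y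
  obtain ⟨h1, h2⟩ := germKey_eq_iff.1 hxy
  refine germKey_eq_iff.2 ?_
  rw [h x hxy, h y rfl]
  refine ⟨by rw [h1], fun i hi => ?_⟩
  have := mulVec_agree hA h2 i hi
  simp [this]

include hG hρ in
theorem IsRayAction.exists_swapsFibres (hG' : ∀ g, IsPeiPerm S g → g ∈ G) (x y : RankRay S k)
    (hne : x.germ ≠ y.germ) : ∃ w, SwapsFibres ρ RankRay.germ w x y := by
  obtain ⟨w, hw, ⟨x', hx', h1⟩, ⟨y', hy', h2⟩, h3⟩ := exists_germ_swap (hG 1 G.one_mem) x.2.1 y.2.1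
    (x.2.2.1.trans y.2.2.1.symm) x.2.2.2 y.2.2.2 hne
  refine ⟨⟨w, hG' w hw⟩, ?_, ?_, fun z hzx hzy => ?_⟩
  · have : ∀ᶠ t in Filter.atTop, ray (ρ ⟨w, hG' w hw⟩ x).1.1 (ρ ⟨w, hG' w hw⟩ x).1.2 t =
        ray x' y.1.2 t := by
      filter_upwards [h1, hρ ⟨w, hG' w hw⟩ x] with t t1 t2
      rw [← t1, ← t2]
    obtain ⟨h4, h5⟩ := ray_eventually_inj this
    have h6 : (ρ ⟨w, hG' w hw⟩ x).1 = (x', y.1.2) := Prod.ext h4 h5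
    exact (congrArg germKey h6).trans hx'
  · have : ∀ᶠ t in Filter.atTop, ray (ρ ⟨w, hG' w hw⟩ y).1.1 (ρ ⟨w, hG' w hw⟩ y).1.2 t =
        ray y' x.1.2 t := by
      filter_upwards [h2, hρ ⟨w, hG' w hw⟩ y] with t t1 t2
      rw [← t1, ← t2]
    obtain ⟨h4, h5⟩ := ray_eventually_inj this
    have h6 : (ρ ⟨w, hG' w hw⟩ y).1 = (y', x.1.2) := Prod.ext h4 h5
    exact (congrArg germKey h6).trans hy'
  · refine RankRay.eq_of_eventually ?_
    filter_upwards [h3 z.1.1 z.1.2 z.2.1 (z.2.2.1.trans x.2.2.1.symm) hzx hzy,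
      hρ ⟨w, hG' w hw⟩ z] with t t1 t2
    rw [← t2]
    exact t1

include hG hρ in
theorem IsRayAction.exists_suppOver {g : G}
    (hg : ¬ MovesRank (k + 1) (g : Equiv.Perm (Fin N → ℤ))) :
    ∃ A : Set ((Fin N → ℤ) × (Fin N → ℤ)), A.Finite ∧ SuppOver ρ RankRay.germ g A := by
  obtain ⟨F, hF, h⟩ := (hG g g.2).exists_finite_cover hg
  refine ⟨germKey '' F, hF.image _, fun q hq => ?_⟩
  refine RankRay.eq_of_eventually ?_
  by_contra hne
  have hfr : ∃ᶠ t in Filter.atTop, (g : Equiv.Perm (Fin N → ℤ)) (ray q.1.1 q.1.2 t) ≠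
      ray q.1.1 q.1.2 t := by
    intro hc
    refine hne ?_
    filter_upwards [hc, hρ g q] with t t1 t2
    rw [← t2]
    exact not_not.1 t1
  obtain ⟨r, hr, h1, h2⟩ := h _ _ q.2.1 q.2.2.1.ge hfr
  exact hq ⟨r, hr, germKey_eq_iff.2 ⟨h1, fun i hi => (h2 i (h1 ▸ hi)).symm⟩⟩

include hG hρ in
theorem IsRayAction.not_movesRank {g : G}
    (hg : ¬ MovesRank (k + 1) (g : Equiv.Perm (Fin N → ℤ))) (h : ρ g = 1) :
    ¬ MovesRank k (g : Equiv.Perm (Fin N → ℤ)) := by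
  rintro ⟨x, ε, hε, hk, hfr⟩
  have hk' : dirRank ε = k := by
    by_contra hne
    exact hg ⟨x, ε, hε, by omega, hfr⟩
  have hS := (hG g g.2).eventually_cone_subset hε
    (hfr.mono fun t ht => (hG g g.2).mem_of_ne ht) (y := x) fun _ _ => rfl
  let q : RankRay S k := ⟨(x, ε), hε, hk', hS.mono fun t ht => ht (self_mem_cone _ _)⟩
  refine hfr ((hρ g q).mono fun t ht => not_not.2 ?_)
  rw [h] at ht
  exact ht

end RayAction

theorem movesRank_mul {k : ℕ} {g h : Equiv.Perm (Fin N → ℤ)} (hgh : MovesRank k (g * h)) :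
    MovesRank k g ∨ MovesRank k h := by
  obtain ⟨x, ε, hε, hk, hfr⟩ := hgh
  by_cases hh : ∃ᶠ t in Filter.atTop, h (ray x ε t) ≠ ray x ε t
  · exact Or.inr ⟨x, ε, hε, hk, hh⟩
  · refine Or.inl ⟨x, ε, hε, hk, (hfr.and_eventually (Filter.not_frequently.1 hh)).mono ?_⟩
    rintro t ⟨h1, h2⟩
    rw [Equiv.Perm.mul_apply, not_not.1 h2] at h1
    exact h1

theorem movesRank_of_inv {k : ℕ} {g : Equiv.Perm (Fin N → ℤ)} (hg : MovesRank k g⁻¹) :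
    MovesRank k g := by
  obtain ⟨x, ε, hε, hk, hfr⟩ := hg
  exact ⟨x, ε, hε, hk, hfr.mono fun t ht h => ht (Equiv.Perm.inv_eq_iff_eq.2 h.symm)⟩

theorem movesRank_of_conj {S : Set (Fin N → ℤ)} {k : ℕ} {g w : Equiv.Perm (Fin N → ℤ)}
    (hw : IsPeiPerm S w⁻¹) (hg : MovesRank k (w * g * w⁻¹)) : MovesRank k g := by
  obtain ⟨x, ε, hε, hk, hfr⟩ := hg
  obtain ⟨a, A, hA, h⟩ := hw.exists_affine x hε
  refine ⟨a + A.mulVec x, A.mulVec ε, hε.mulVec hA, hk.trans (dirRank_mulVec hA ε).ge,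
    (hfr.and_eventually (h x fun _ _ => rfl)).mono ?_⟩
  rintro t ⟨h1, h2⟩ h3
  refine h1 ?_
  rw [Equiv.Perm.mul_apply, Equiv.Perm.mul_apply, h2, h3, ← h2]
  simp

theorem not_movesRank_zero_iff {g : Equiv.Perm (Fin N → ℤ)} : ¬ MovesRank 0 g ↔ g = 1 := by
  constructor
  · intro h
    ext1 x
    by_contra hx
    refine h ⟨x, 0, fun i => by simp, Nat.zero_le _, ?_⟩
    have : ∀ t, ray x 0 t = x := fun t => by ext i; simp [ray]
    simp only [this]
    exact (Filter.Eventually.of_forall fun _ => hx).frequently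
  · rintro rfl ⟨x, ε, -, -, h⟩
    exact h (Filter.Eventually.of_forall fun t => by simp)

theorem not_movesRank_of_lt {k : ℕ} (hk : N < k) (g : Equiv.Perm (Fin N → ℤ)) :
    ¬ MovesRank k g := by
  rintro ⟨x, ε, -, h, -⟩
  exact absurd (h.trans (dirRank_le ε)) (by omega)

/-- The elements of a group of pei-permutations moving no germs of rank at least `k`. -/
def lowRank (G : Subgroup (Equiv.Perm (Fin N → ℤ))) (k : ℕ) : Subgroup G where
  carrier := {g | ¬ MovesRank k (g : Equiv.Perm (Fin N → ℤ))}
  one_mem' := by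
    rintro ⟨x, ε, -, -, h⟩
    exact h (Filter.Eventually.of_forall fun t => by simp)
  mul_mem' := fun hg hh h => (movesRank_mul h).elim hg hh
  inv_mem' := fun hg h => hg (movesRank_of_inv h)

theorem lowRank_normal {S : Set (Fin N → ℤ)} {G : Subgroup (Equiv.Perm (Fin N → ℤ))}
    (hG : ∀ g ∈ G, IsPeiPerm S g) (k : ℕ) : (lowRank G k).Normal :=
  ⟨fun _ hg w h => hg (movesRank_of_conj (hG _ (G.inv_mem w.2)) h)⟩

section Chains

variable {G : Type*} [Group G] {c : ℕ → Subgroup G}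

/-- The chain `c` of subgroups stabilizes inside `K`. -/
def StableOn (c : ℕ → Subgroup G) (K : Set G) : Prop :=
  ∃ n, ∀ m, n ≤ m → ∀ g ∈ c m, g ∈ K → g ∈ c n

theorem StableOn.of_hom {M : Type*} [AddCommGroup M] [IsNoetherian ℤ M] (hc : Monotone c)
    {K : Set G} {T : Subgroup G} (b : T →* Multiplicative M) (hb : ∀ g : T, b g = 1 → (g : G) ∈ K)
    (hK : StableOn c K) : StableOn c (T : Set G) := by
  obtain ⟨n₁, h₁⟩ := hK
  let I : ℕ →o Submodule ℤ M :=
    { toFun := fun n => AddSubgroup.toIntSubmodule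
        (Subgroup.toAddSubgroup' ((((c n).subgroupOf T)).map b))
      monotone' := fun i j hij => by
        intro x hx
        obtain ⟨g, hg, hgx⟩ := hx
        exact ⟨g, hc hij hg, hgx⟩ }
  obtain ⟨n₂, h₂⟩ := monotone_stabilizes_iff_noetherian.2 ‹IsNoetherian ℤ M› I
  refine ⟨max n₁ n₂, fun m hm g hg hgT => ?_⟩
  have hmem : (b ⟨g, hgT⟩).toAdd ∈ I m := ⟨⟨g, hgT⟩, hg, rfl⟩
  rw [← h₂ m ((le_max_right _ _).trans hm)] at hmem
  obtain ⟨h, hh, hbh⟩ := hmem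
  have hbh' : b h = b ⟨g, hgT⟩ := hbh
  have hker : b (h⁻¹ * ⟨g, hgT⟩) = 1 := by rw [map_mul, map_inv, hbh', inv_mul_cancel]
  have h3 : (h : G) ∈ c (max n₁ n₂) := hc (le_max_right _ _) hh
  have h4 : ((h⁻¹ * ⟨g, hgT⟩ : T) : G) ∈ c n₁ := by
    refine h₁ m ((le_max_left _ _).trans hm) _ ?_ (hb _ hker)
    exact (c m).mul_mem ((c m).inv_mem (hc hm h3)) hg
  have := (c _).mul_mem h3 (hc (le_max_left n₁ n₂) h4)
  simpa using this

theorem StableOn.of_finite {Y : Type*} (hc : Monotone c) {T U : Set G} (τ : G → Y)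
    (hτ : (τ '' U).Finite) (h : ∀ g ∈ U, ∀ h ∈ U, τ g = τ h → h⁻¹ * g ∈ T)
    (hT : StableOn c T) : StableOn c U := by
  obtain ⟨n₁, h₁⟩ := hT
  have hev : ∀ᶠ n in Filter.atTop, ∀ y ∈ τ '' U, ∀ m,
      y ∈ τ '' (c m ∩ U) → y ∈ τ '' (c n ∩ U) := by
    refine (Filter.eventually_all_finite hτ).2 fun y _ => ?_
    by_cases hy : ∃ m, y ∈ τ '' (c m ∩ U)
    · obtain ⟨m, g, ⟨hgm, hgU⟩, rfl⟩ := hy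
      filter_upwards [Filter.eventually_ge_atTop m] with n hn _ _
      exact ⟨g, ⟨hc hn hgm, hgU⟩, rfl⟩
    · exact Filter.Eventually.of_forall fun n m hm => absurd ⟨m, hm⟩ hy
  obtain ⟨n, hn, hn'⟩ := (hev.and (Filter.eventually_ge_atTop n₁)).exists
  refine ⟨n, fun m hm g hg hgU => ?_⟩
  obtain ⟨h', ⟨hh, hhU⟩, heq⟩ := hn _ ⟨g, hgU, rfl⟩ m ⟨g, ⟨hg, hgU⟩, rfl⟩
  have := h₁ m (hn'.trans hm) _ ((c m).mul_mem ((c m).inv_mem (hc hm hh)) hg) (h g hgU h' hhU heq.symm)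
  simpa using (c n).mul_mem hh (hc hn' this)

end Chains

theorem finite_isOrthMat : {A : Matrix (Fin N) (Fin N) ℤ | IsOrthMat A}.Finite := by
  have : {A : Matrix (Fin N) (Fin N) ℤ | ∀ i j, A i j ∈ Set.Icc (-1 : ℤ) 1}.Finite :=
    Set.Finite.pi' fun i => Set.Finite.pi' fun j => Set.finite_Icc _ _
  refine this.subset fun A hA i j => ?_
  obtain ⟨σ, s, hs, h⟩ := orthMat_signed hA
  have hij := h (Pi.single j 1) i
  rw [Matrix.mulVec_single_one] at hij
  have hij' : A i j = s i * (Pi.single j 1 : Fin N → ℤ) (σ i) := hij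
  rw [hij', Pi.single_apply]
  rcases hs i with h | h <;> split_ifs <;> simp [h]

section RayChains

variable {S : Set (Fin N → ℤ)} {G : Subgroup (Equiv.Perm (Fin N → ℤ))} {k : ℕ}
  {ρ : G →* Equiv.Perm (RankRay S k)}

/-- The elements acting by a translation on each germ, and trivially on the germs outside `A`. -/
def translationSubgroup (ρ : G →* Equiv.Perm (RankRay S k))
    (A : Set ((Fin N → ℤ) × (Fin N → ℤ))) : Subgroup G where
  carrier := {g | SuppOver ρ RankRay.germ g A ∧ ∀ q : RankRay S k, (ρ g q).germ = q.germ ∧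
    ∀ r : RankRay S k, r.germ = q.germ → (ρ g r).1.1 - r.1.1 = (ρ g q).1.1 - q.1.1}
  one_mem' := ⟨fun z _ => by simp, fun q => ⟨by simp, fun r _ => by simp⟩⟩
  mul_mem' := by
    rintro g h ⟨hg1, hg2⟩ ⟨hh1, hh2⟩
    refine ⟨fun z hz => ?_, fun q => ⟨?_, fun r hr => ?_⟩⟩
    · rw [map_mul, Equiv.Perm.mul_apply, hh1 z hz, hg1 z hz]
    · rw [map_mul, Equiv.Perm.mul_apply, (hg2 _).1, (hh2 q).1]
    · rw [map_mul, Equiv.Perm.mul_apply, Equiv.Perm.mul_apply]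
      have h1 := (hh2 q).2 r hr
      have h2 := (hg2 (ρ h q)).2 (ρ h r) (by rw [(hh2 q).1, (hh2 r).1, hr])
      rw [← sub_add_sub_cancel _ (ρ h r).1.1 r.1.1, h1, h2, sub_add_sub_cancel]
  inv_mem' := by
    rintro g ⟨hg1, hg2⟩
    have hinv : ∀ q, ρ g (ρ g⁻¹ q) = q := fun q => by simp
    have hgerm : ∀ q : RankRay S k, (ρ g⁻¹ q).germ = q.germ := fun q => by
      rw [← (hg2 (ρ g⁻¹ q)).1, hinv]
    refine ⟨hg1.inv, fun q => ⟨hgerm q, fun r hr => ?_⟩⟩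
    have := (hg2 (ρ g⁻¹ q)).2 (ρ g⁻¹ r) (by rw [hgerm, hgerm, hr])
    rw [hinv, hinv] at this
    rw [← neg_sub, this, neg_sub]

theorem exists_germ_representatives (S : Set (Fin N → ℤ)) (k : ℕ)
    {A : Set ((Fin N → ℤ) × (Fin N → ℤ))} (hA : A.Finite) :
    ∃ R : Set (RankRay S k), R.Finite ∧ ∀ q : RankRay S k, q.germ ∈ A → ∃ r ∈ R, r.germ = q.germ := by
  have hfin : (A ∩ Set.range (RankRay.germ : RankRay S k → _)).Finite :=
    hA.subset Set.inter_subset_left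
  have : ∀ γ : (Fin N → ℤ) × (Fin N → ℤ), γ ∈ A ∩ Set.range (RankRay.germ : RankRay S k → _) →
      ∃ q : RankRay S k, q.germ = γ := fun γ hγ => hγ.2
  by_cases hne : Nonempty (RankRay S k)
  · choose! f hf using this
    refine ⟨f '' (A ∩ Set.range RankRay.germ), hfin.image f, fun q hq => ?_⟩
    exact ⟨f q.germ, ⟨q.germ, ⟨hq, q, rfl⟩, rfl⟩, hf _ ⟨hq, q, rfl⟩⟩
  · exact ⟨∅, Set.finite_empty, fun q => absurd ⟨q⟩ hne⟩

variable (hG : ∀ g ∈ G, IsPeiPerm S g) (hρ : IsRayAction ρ) {c : ℕ → Subgroup G}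
  (hc : Monotone c) {A : Set ((Fin N → ℤ) × (Fin N → ℤ))} (hA : A.Finite)

include hG hρ hc hA in
theorem stableOn_translations (h : StableOn c (lowRank G k : Set G)) :
    StableOn c ((translationSubgroup ρ A ⊓ lowRank G (k + 1) : Subgroup G) : Set G) := by
  obtain ⟨R, hR, hRA⟩ := exists_germ_representatives S k hA
  have := hR.fintype
  let b : (translationSubgroup ρ A ⊓ lowRank G (k + 1) : Subgroup G) →*
      Multiplicative (R → Fin N → ℤ) :=
    MonoidHom.mk' (fun g => Multiplicative.ofAdd fun r => (ρ g r.1).1.1 - r.1.1.1) (by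
      intro g h
      rw [← ofAdd_add]
      congr 1
      ext1 r
      have := (g.2.1.2 r.1).2 (ρ h r.1) (h.2.1.2 r.1).1
      rw [Pi.add_apply, ← this, Subgroup.coe_mul, map_mul, Equiv.Perm.mul_apply,
        sub_add_sub_cancel])
  refine h.of_hom hc b fun g hg => ?_
  refine hρ.not_movesRank hG g.2.2 ?_
  ext1 q
  rw [Equiv.Perm.one_apply]
  by_cases hq : q.germ ∈ A
  · obtain ⟨r, hr, hrq⟩ := hRA q hq
    have h1 : (ρ g r).1.1 - r.1.1 = 0 := congrFun hg ⟨r, hr⟩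
    rw [(g.2.1.2 q).2 r hrq, sub_eq_zero] at h1
    exact Subtype.ext (Prod.ext h1 (germKey_eq_iff.1 (g.2.1.2 q).1).1)
  · exact g.2.1.1 q hq

include hG hρ hc hA in
theorem stableOn_suppOver
    (h : StableOn c ((translationSubgroup ρ A ⊓ lowRank G (k + 1) : Subgroup G) : Set G)) :
    StableOn c {g | SuppOver ρ RankRay.germ g A ∧ g ∈ lowRank G (k + 1)} := by
  obtain ⟨R, hR, hRA⟩ := exists_germ_representatives S k hA
  have := hR.fintype
  have hperm := hρ.permutesFibres hG
  choose a M hM haM using hρ.exists_affine hG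
  have hMem : ∀ g, SuppOver ρ RankRay.germ g A → ∀ q : RankRay S k, q.germ ∈ A →
      (ρ g q).germ ∈ A := by
    intro g hg q hq
    by_contra hn
    have := (ρ g).injective (hg _ hn)
    rw [this] at hn
    exact hn hq
  refine h.of_finite hc (T := _) (fun g => fun r : R => ((ρ g r.1).germ, M g r.1)) ?_ ?_
  · have : {f : R → ((Fin N → ℤ) × (Fin N → ℤ)) × Matrix (Fin N) (Fin N) ℤ |
        ∀ r, f r ∈ insert r.1.germ A ×ˢ {A | IsOrthMat A}}.Finite :=
      Set.Finite.pi' fun r => (hA.insert _).prod finite_isOrthMat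
    refine this.subset ?_
    rintro _ ⟨g, ⟨hg, -⟩, rfl⟩ r
    refine ⟨?_, hM g r⟩
    by_cases hr : r.1.germ ∈ A
    · exact Or.inr (hMem g hg r hr)
    · exact Or.inl (congrArg RankRay.germ (hg _ hr))
  · rintro g ⟨hg, hgk⟩ h ⟨hh, hhk⟩ heq
    have hmv : ∀ x y, ρ (h⁻¹ * g) x = y ↔ ρ g x = ρ h y := fun x y => by
      rw [map_mul, Equiv.Perm.mul_apply, map_inv_apply_eq_iff]
    have hsupp : SuppOver ρ RankRay.germ (h⁻¹ * g) A := fun q hq => by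
      rw [hmv, hg q hq, hh q hq]
    refine ⟨⟨hsupp, fun q => ?_⟩, (lowRank G (k + 1)).mul_mem (Subgroup.inv_mem _ hhk) hgk⟩
    by_cases hq : q.germ ∈ A
    · obtain ⟨r, hr, hrq⟩ := hRA q hq
      obtain ⟨e1, e2⟩ := Prod.ext_iff.1 (congrFun heq ⟨r, hr⟩)
      have hger : ∀ z : RankRay S k, z.germ = r.germ → (ρ (h⁻¹ * g) z).germ = r.germ := by
        intro z hz
        rw [hperm _ _ _ hz]
        rw [map_mul, Equiv.Perm.mul_apply]
        exact hperm.inv_of_eq e1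
      have key : ∀ z : RankRay S k, z.germ = r.germ →
          (ρ (h⁻¹ * g) z).1.1 - z.1.1 = (M g r).transpose.mulVec (a g r - a h r) := by
        intro z hz
        have h1 : ρ g z = ρ h (ρ (h⁻¹ * g) z) := (hmv z _).1 rfl
        have h2 := haM g r z hz
        rw [h1, haM h r _ (hger z hz)] at h2
        have h3 := (Prod.ext_iff.1 h2).1
        simp only at e2 h3
        rw [← e2] at h3
        have h4 : (M g r).mulVec ((ρ (h⁻¹ * g) z).1.1 - z.1.1) = a g r - a h r := by
          rw [Matrix.mulVec_sub, sub_eq_sub_iff_add_eq_add, add_comm, h3]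
        rw [← h4, Matrix.mulVec_mulVec, (hM g r).transpose_mul, Matrix.one_mulVec]
      refine ⟨(hger q hrq.symm).trans hrq, fun z hz => ?_⟩
      rw [key z (hz.trans hrq.symm), key q hrq.symm]
    · refine ⟨by rw [hsupp q hq], fun z hz => ?_⟩
      rw [hsupp q hq, hsupp z (hz ▸ hq), sub_self, sub_self]

theorem stableOn_lowRank {S : Set (Fin N → ℤ)} {G : Subgroup (Equiv.Perm (Fin N → ℤ))}
    (hG : ∀ g, g ∈ G ↔ IsPeiPerm S g) {c : ℕ → Subgroup G} (hc : Monotone c)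
    (hn : ∀ n, (c n).Normal) (k : ℕ) : StableOn c (lowRank G k : Set G) := by
  have hG' : ∀ g ∈ G, IsPeiPerm S g := fun g => (hG g).1
  induction k with
  | zero =>
    refine ⟨0, fun m _ g _ hg => ?_⟩
    have : g = 1 := Subtype.ext (not_movesRank_zero_iff.1 hg)
    rw [this]
    exact (c 0).one_mem
  | succ k ih =>
    obtain ⟨ρ, hρ⟩ := exists_isRayAction hG' k
    obtain ⟨Γ₀, hΓ₀⟩ := exists_finset_control (hρ.permutesFibres hG')
      (hρ.exists_swapsFibres hG' fun g => (hG g).2)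
    obtain ⟨n, h⟩ := stableOn_suppOver hG' hρ hc Γ₀.finite_toSet
      (stableOn_translations hG' hρ hc Γ₀.finite_toSet ih)
    refine ⟨n, fun m hm g hg hgk => ?_⟩
    obtain ⟨A, hA, hgA⟩ := hρ.exists_suppOver hG' hgk
    have h1 := hn m
    have h2 := lowRank_normal hG' (k + 1)
    exact hΓ₀ (c n) (c m ⊓ lowRank G (k + 1)) (hn n) inferInstance
      (fun g hg hgs => h m hm g hg.1 ⟨hgs, hg.2⟩) g ⟨hg, hgk⟩ A hA hgA

end RayChains

section Transpositions

open Equiv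

variable {α : Type*} [DecidableEq α]

theorem commute_swap_swap {a b c d : α} (hca : c ≠ a) (hcb : c ≠ b) (hda : d ≠ a)
    (hdb : d ≠ b) : swap a b * swap c d = swap c d * swap a b := by
  rw [mul_swap_eq_swap_mul, swap_apply_of_ne_of_ne hca hcb, swap_apply_of_ne_of_ne hda hdb]

theorem swap_conj_swap {a b c : α} (hac : a ≠ c) (hbc : b ≠ c) :
    swap a b * swap a c * swap a b = swap b c := by
  have h : swap a b * swap a c = swap b c * swap a b := by
    rw [mul_swap_eq_swap_mul, swap_apply_left, swap_apply_of_ne_of_ne hac.symm hbc.symm]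
  rw [h, mul_assoc, swap_mul_self, mul_one]

/-- A product of two transpositions has order at most `3`. -/
theorem swap_mul_swap_sq_or_cube {a b c d : α} (hab : a ≠ b) (hcd : c ≠ d) :
    (swap a b * swap c d) * (swap a b * swap c d) = 1 ∨
      (swap a b * swap c d) * (swap a b * swap c d) * (swap a b * swap c d) = 1 := by
  have key : ∀ {a b d : α}, a ≠ b → a ≠ d →
      (swap a b * swap a d) * (swap a b * swap a d) = 1 ∨
      (swap a b * swap a d) * (swap a b * swap a d) * (swap a b * swap a d) = 1 := by
    intro a b d hab had
    by_cases hbd : b = d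
    · subst hbd
      simp
    · right
      have h1 := swap_conj_swap had hbd
      have h2 := swap_conj_swap hab (Ne.symm hbd)
      calc _ = (swap a b * swap a d * swap a b) * (swap a d * swap a b * swap a d) := by group
        _ = 1 := by rw [h1, h2, swap_comm d b, swap_mul_self]
  by_cases hca : c = a
  · subst hca
    exact key hab hcd
  by_cases hda : d = a
  · subst hda
    rw [swap_comm c d]
    exact key hab hcd.symm
  by_cases hcb : c = b
  · subst hcb
    rw [swap_comm a c]
    exact key hab.symm hcd
  by_cases hdb : d = b
  · subst hdb
    rw [swap_comm a d, swap_comm c d]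
    exact key hab.symm hcd.symm
  left
  rw [mul_assoc, ← mul_assoc (swap c d), ← commute_swap_swap hca hcb hda hdb, mul_assoc,
    swap_mul_self, mul_one, swap_mul_self]

/-- A group-theoretic description of transpositions. -/
def TranspositionLike {G : Type*} [Group G] (t : G) : Prop :=
  t ≠ 1 ∧ t * t = 1 ∧ ∀ g : G, (t * (g * t * g⁻¹)) * (t * (g * t * g⁻¹)) = 1 ∨
    (t * (g * t * g⁻¹)) * (t * (g * t * g⁻¹)) * (t * (g * t * g⁻¹)) = 1

theorem TranspositionLike.map {G : Type*} [Group G] {t : G} (h : TranspositionLike t)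
    (e : G ≃* G) : TranspositionLike (e t) := by
  obtain ⟨h1, h2, h3⟩ := h
  refine ⟨fun h => h1 (e.injective (by rw [h, map_one])), by rw [← map_mul, h2, map_one],
    fun g => ?_⟩
  obtain ⟨g, rfl⟩ := e.surjective g
  simp only [← map_mul, ← map_inv]
  rcases h3 g with h | h
  · exact Or.inl (by rw [h, map_one])
  · exact Or.inr (by rw [h, map_one])

variable {S : Set α} {G : Subgroup (Perm α)}

theorem transpositionLike_swap {x y : α} (hxy : x ≠ y) (h : swap x y ∈ G) :
    TranspositionLike (⟨swap x y, h⟩ : G) := by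
  refine ⟨fun h => hxy ?_, Subtype.ext (swap_mul_self _ _), fun g => ?_⟩
  · have := congrArg (fun t : G => (t : Perm α) x) h
    simpa using this.symm
  · simp only [Subtype.ext_iff, Subgroup.coe_mul, Subgroup.coe_inv, Subgroup.coe_one]
    rw [mul_swap_eq_swap_mul, mul_inv_cancel_right]
    exact swap_mul_swap_sq_or_cube hxy fun h => hxy ((g : Perm α).injective h)

variable (hS : S.Infinite) (hfix : ∀ g ∈ G, ∀ x ∉ S, g x = x)
  (hsw : ∀ x ∈ S, ∀ y ∈ S, swap x y ∈ G)

include hS hfix hsw in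
theorem TranspositionLike.exists_eq_swap {t : G} (ht : TranspositionLike t) :
    ∃ x ∈ S, ∃ y ∈ S, x ≠ y ∧ (t : Perm α) = swap x y := by
  obtain ⟨t, htG⟩ := t
  obtain ⟨h1, h2, h3⟩ := ht
  have htt : ∀ x, t (t x) = x := fun x =>
    congrArg (fun s : G => (s : Perm α) x) h2
  have hmem : ∀ x, t x ≠ x → x ∈ S := fun x hx => by
    by_contra h
    exact hx (hfix t htG x h)
  have hmem' : ∀ x, t x ≠ x → t x ∈ S := fun x hx => hmem _ (by rw [htt]; exact hx.symm)
  have hy : ∀ g ∈ G, ∀ a, (∀ y : α → α, (∀ z, y z = t (g (t (g⁻¹ z)))) → y (y a) ≠ a ∧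
      y (y (y a)) ≠ a) → False := by
    intro g hg a h
    obtain ⟨e1, e2⟩ := h _ fun _ => rfl
    rcases h3 ⟨g, hg⟩ with h | h
    · exact e1 (congrArg (fun s : G => (s : Perm α) a) h)
    · exact e2 (congrArg (fun s : G => (s : Perm α) a) h)
  obtain ⟨a, ha⟩ : ∃ a, t a ≠ a := by
    by_contra! hc
    exact h1 (Subtype.ext (Equiv.ext hc))
  refine ⟨a, hmem a ha, t a, hmem' a ha, ha.symm, ?_⟩
  by_contra hne
  obtain ⟨c, hc⟩ : ∃ c, t c ≠ swap a (t a) c := by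
    by_contra! hc
    exact hne (Equiv.ext hc)
  have hca : c ≠ a := by
    rintro rfl
    simp at hc
  have hcb : c ≠ t a := by
    rintro rfl
    simp [htt] at hc
  rw [swap_apply_of_ne_of_ne hca hcb] at hc
  have haS := hmem a ha
  have hbS := hmem' a ha
  have hcS := hmem c hc
  have hdS := hmem' c hc
  obtain ⟨b, hb⟩ : ∃ b, b = t a := ⟨_, rfl⟩
  obtain ⟨d, hd⟩ : ∃ d, d = t c := ⟨_, rfl⟩
  have htb : t b = a := by rw [hb, htt]
  have htd : t d = c := by rw [hd, htt]
  rw [← hb] at hcb ha hbS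
  rw [← hd] at hc hdS
  have hda : d ≠ a := by grind
  have hdb : d ≠ b := by grind
  by_cases hf : ∃ f ∈ S, t f = f
  · obtain ⟨f, hfS, hff⟩ := hf
    have hfa : f ≠ a := by grind
    have hfb : f ≠ b := by grind
    have hfc : f ≠ c := by grind
    have hfd : f ≠ d := by grind
    refine hy (swap a b * swap b c * swap c d * swap d f) (G.mul_mem (G.mul_mem (G.mul_mem
      (hsw _ haS _ hbS) (hsw _ hbS _ hcS)) (hsw _ hcS _ hdS)) (hsw _ hdS _ hfS)) a ?_
    set g := swap a b * swap b c * swap c d * swap d f with hg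
    have ga : g a = b := by simp [hg, swap_apply_def]; grind
    have gb : g b = c := by simp [hg, swap_apply_def]; grind
    have gc : g c = d := by simp [hg, swap_apply_def]; grind
    have gd : g d = f := by simp [hg, swap_apply_def]; grind
    have gf : g f = a := by simp [hg]
    have ga' : g⁻¹ a = f := Perm.inv_eq_iff_eq.2 gf.symm
    have gb' : g⁻¹ b = a := Perm.inv_eq_iff_eq.2 ga.symm
    have gd' : g⁻¹ d = c := Perm.inv_eq_iff_eq.2 gc.symm
    intro y hyz
    have e1 : y a = b := by rw [hyz, ga', hff, gf, hb]
    have e2 : y b = d := by rw [hyz, gb', ← hb, gb, hd]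
    have e3 : y d = f := by rw [hyz, gd', ← hd, gd, hff]
    rw [e1, e2, e3]
    exact ⟨hda, hfa⟩
  · push Not at hf
    obtain ⟨p, hpS, hp⟩ := hS.exists_notMem_finset {a, b, c, d}
    obtain ⟨q, hq⟩ : ∃ q, q = t p := ⟨_, rfl⟩
    have hqS := hmem' p (hf p hpS)
    rw [← hq] at hqS
    obtain ⟨r, hrS, hr⟩ := hS.exists_notMem_finset {a, b, c, d, p, q}
    obtain ⟨s, hs⟩ : ∃ s, s = t r := ⟨_, rfl⟩
    have hsS := hmem' r (hf r hrS)
    rw [← hs] at hsS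
    have hqp := hf p hpS
    have hsr := hf r hrS
    have htq : t q = p := by rw [hq, htt]
    have hts : t s = r := by rw [hs, htt]
    simp only [Finset.mem_insert, Finset.mem_singleton, not_or] at hp hr
    have hq' : q ≠ a ∧ q ≠ b ∧ q ≠ c ∧ q ≠ d := by grind
    have hs' : s ≠ a ∧ s ≠ b ∧ s ≠ c ∧ s ≠ d ∧ s ≠ p ∧ s ≠ q := by grind
    refine hy (swap b d * swap d q * swap q s) (G.mul_mem (G.mul_mem
      (hsw _ hbS _ hdS) (hsw _ hdS _ hqS)) (hsw _ hqS _ hsS)) a ?_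
    set g := swap b d * swap d q * swap q s with hg
    have ga : g a = a := by simp [hg, swap_apply_def]; grind
    have gc : g c = c := by simp [hg, swap_apply_def]; grind
    have gp : g p = p := by simp [hg, swap_apply_def]; grind
    have gb : g b = d := by simp [hg, swap_apply_def]; grind
    have gd : g d = q := by simp [hg, swap_apply_def]; grind
    have gq : g q = s := by simp [hg, swap_apply_def]; grind
    have ga' : g⁻¹ a = a := Perm.inv_eq_iff_eq.2 ga.symm
    have gc' : g⁻¹ c = c := Perm.inv_eq_iff_eq.2 gc.symm
    have gp' : g⁻¹ p = p := Perm.inv_eq_iff_eq.2 gp.symm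
    intro y hyz
    have e1 : y a = c := by rw [hyz, ga', ← hb, gb, htd]
    have e2 : y c = p := by rw [hyz, gc', ← hd, gd, htq]
    have e3 : y p = r := by rw [hyz, gp', ← hq, gq, hts]
    rw [e1, e2, e3]
    exact ⟨hp.1, hr.1⟩

theorem eq_swap_of_moves {t : Perm α} {x y a b : α} (ht : t = swap x y) (ha : t a ≠ a)
    (hb : t b ≠ b) (hab : a ≠ b) : t = swap a b := by
  subst ht
  have ha' : a = x ∨ a = y := by
    by_contra! h
    exact ha (swap_apply_of_ne_of_ne h.1 h.2)
  have hb' : b = x ∨ b = y := by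
    by_contra! h
    exact hb (swap_apply_of_ne_of_ne h.1 h.2)
  rcases ha' with rfl | rfl <;> rcases hb' with rfl | rfl
  exacts [absurd rfl hab, rfl, swap_comm _ _, absurd rfl hab]

theorem exists_eq_swap_of_moves {t : Perm α} {x y a : α} (ht : t = swap x y) (ha : t a ≠ a) :
    t = swap a (t a) :=
  eq_swap_of_moves ht ha (fun h => ha (t.injective h)) ha.symm

include hS hfix hsw in
/-- Every automorphism of a group of permutations of an infinite set containing all transpositions
is spatial. -/
theorem exists_spatial (e : G ≃* G) : ∃ φ : α → α, Set.BijOn φ S S ∧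
    ∀ (g : G), ∀ x ∈ S, (e g : Perm α) (φ x) = φ ((g : Perm α) x) := by
  have hmaps : ∀ g ∈ G, ∀ x ∈ S, g x ∈ S := by
    intro g hg x hx
    by_contra h
    have := g.injective (hfix g hg _ h)
    rw [this] at h
    exact h hx
  let T : S → S → Perm α := fun x y => e ⟨swap x.1 y.1, hsw _ x.2 _ y.2⟩
  have Tsymm : ∀ x y, T x y = T y x := by
    intro x y
    simp only [T, swap_comm x.1 y.1]
  have Tswap : ∀ x y, x ≠ y → ∃ a ∈ S, ∃ b ∈ S, a ≠ b ∧ T x y = swap a b := by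
    intro x y hxy
    exact ((transpositionLike_swap (fun h => hxy (Subtype.ext h)) _).map e).exists_eq_swap
      hS hfix hsw
  have Tmem : ∀ x y a, x ≠ y → T x y a ≠ a → a ∈ S := by
    intro x y a _ ha
    by_contra h
    exact ha (hfix _ (e _).2 a h)
  have Tinj : ∀ x y z w, T x y = T z w → swap x.1 y.1 = swap z.1 w.1 := by
    intro x y z w h
    exact congrArg Subtype.val (e.injective (Subtype.ext h))
  have Tconj : ∀ x y z : S, x ≠ y → x ≠ z → y ≠ z → T x y * T x z * T x y = T y z := by
    intro x y z hxy hxz hyz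
    simp only [T, ← Subgroup.coe_mul, ← map_mul]
    congr 2
    exact Subtype.ext (swap_conj_swap (fun h => hxz (Subtype.ext h))
      fun h => hyz (Subtype.ext h))
  have Tne : ∀ x y z : S, x ≠ y → y ≠ z → T x y ≠ T x z := by
    intro x y z hxy hyz h
    have := congrArg (fun t : Perm α => t x) (Tinj _ _ _ _ h)
    simp only [swap_apply_left] at this
    exact hyz (Subtype.ext this)
  have Tcommon : ∀ x y z : S, x ≠ y → x ≠ z → y ≠ z → ∃ p, T x y p ≠ p ∧ T x z p ≠ p := by
    intro x y z hxy hxz hyz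
    obtain ⟨a, -, b, -, hab, h1⟩ := Tswap x y hxy
    by_contra! hc
    have ha : T x z a = a := hc a (by rw [h1, swap_apply_left]; exact hab.symm)
    have hb : T x z b = b := hc b (by rw [h1, swap_apply_right]; exact hab)
    have h2 := Tconj x z y hxz hxy hyz.symm
    rw [h1, mul_swap_eq_swap_mul, ha, hb, ← h1, mul_assoc] at h2
    have h3 : T x z * T x z = 1 := by
      obtain ⟨u, -, v, -, -, h⟩ := Tswap x z hxz
      rw [h, swap_mul_self]
    rw [h3, mul_one, Tsymm x y, Tsymm z y] at h2
    exact Tne y x z hxy.symm hxz h2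
  have Tthird : ∀ x : S, ∀ y : S, ∃ z : S, z ≠ x ∧ z ≠ y := by
    intro x y
    obtain ⟨z, hzS, hz⟩ := hS.exists_notMem_finset {x.1, y.1}
    simp only [Finset.mem_insert, Finset.mem_singleton, not_or] at hz
    exact ⟨⟨z, hzS⟩, fun h => hz.1 (congrArg Subtype.val h), fun h => hz.2 (congrArg Subtype.val h)⟩
  have hex : ∀ x : S, ∃ p : S, ∀ y, y ≠ x → T x y p ≠ p := by
    intro x
    obtain ⟨y, hyx, -⟩ := Tthird x x
    obtain ⟨z, hzx, hzy⟩ := Tthird x y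
    obtain ⟨p, hp1, hp2⟩ := Tcommon x y z hyx.symm hzx.symm hzy.symm
    refine ⟨⟨p, Tmem x y p hyx.symm hp1⟩, fun w hwx hw => ?_⟩
    simp only at hw
    have hwy : w ≠ y := by rintro rfl; exact hp1 hw
    have hwz : w ≠ z := by rintro rfl; exact hp2 hw
    obtain ⟨_, -, _, -, -, h1⟩ := Tswap x y hyx.symm
    obtain ⟨_, -, _, -, -, h2⟩ := Tswap x z hzx.symm
    obtain ⟨_, -, _, -, -, h3⟩ := Tswap x w hwx.symm
    have h1' := exists_eq_swap_of_moves h1 hp1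
    have h2' := exists_eq_swap_of_moves h2 hp2
    have hq : T x w (T x y p) ≠ T x y p := by
      obtain ⟨q, hq1, hq2⟩ := Tcommon x y w hyx.symm hwx.symm hwy.symm
      by_cases hqp : q = p
      · exact absurd (hqp ▸ hw) hq2
      · have := eq_swap_of_moves h1 hp1 hq1 (Ne.symm hqp)
        rw [this, swap_apply_left]
        exact hq2
    have hr : T x w (T x z p) ≠ T x z p := by
      obtain ⟨q, hq1, hq2⟩ := Tcommon x z w hzx.symm hwx.symm hwz.symm
      by_cases hqp : q = p
      · exact absurd (hqp ▸ hw) hq2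
      · have := eq_swap_of_moves h2 hp2 hq1 (Ne.symm hqp)
        rw [this, swap_apply_left]
        exact hq2
    have hqr : T x y p ≠ T x z p := fun h => by
      rw [h, ← h2'] at h1'
      exact Tne x y z hyx.symm hzy.symm h1'
    have h4 := eq_swap_of_moves h3 hq hr hqr
    have h5 := Tconj x y z hyx.symm hzx.symm hzy.symm
    rw [h1', h2', swap_conj_swap hp2.symm hqr, ← h4] at h5
    have h6 := congrArg (fun t : Perm α => t x) (Tinj _ _ _ _ h5)
    simp only [swap_apply_left] at h6
    rw [swap_apply_of_ne_of_ne (fun h => hyx (Subtype.ext h.symm))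
      fun h => hzx (Subtype.ext h.symm)] at h6
    exact hwx (Subtype.ext h6)
  have huniq : ∀ (x : S) (p q : α), (∀ y, y ≠ x → T x y p ≠ p) → (∀ y, y ≠ x → T x y q ≠ q) →
      p = q := by
    intro x p q hp hq
    by_contra hne
    obtain ⟨y, hyx, -⟩ := Tthird x x
    obtain ⟨z, hzx, hzy⟩ := Tthird x y
    obtain ⟨_, -, _, -, -, h1⟩ := Tswap x y hyx.symm
    obtain ⟨_, -, _, -, -, h2⟩ := Tswap x z hzx.symm
    refine Tne x y z hyx.symm hzy.symm ?_
    rw [eq_swap_of_moves h1 (hp y hyx) (hq y hyx) hne, eq_swap_of_moves h2 (hp z hzx) (hq z hzx) hne]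
  choose ψ hψ using hex
  have hinj : Function.Injective ψ := by
    intro x y hxy
    by_contra hne
    obtain ⟨z, hzx, hzy⟩ := Tthird x y
    have m1 := hψ x y (Ne.symm hne)
    have m2 := hψ x z hzx
    have m3 := hψ y z hzy
    rw [← hxy] at m3
    obtain ⟨_, -, _, -, -, h1⟩ := Tswap x y hne
    obtain ⟨_, -, _, -, -, h2⟩ := Tswap x z hzx.symm
    have h1' := exists_eq_swap_of_moves h1 m1
    have h2' := exists_eq_swap_of_moves h2 m2
    have hqr : T x y (ψ x) ≠ T x z (ψ x) := fun h => by
      rw [h, ← h2'] at h1'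
      exact Tne x y z hne hzy.symm h1'
    have h5 := Tconj x y z hne hzx.symm hzy.symm
    rw [h1', h2', swap_conj_swap m2.symm hqr] at h5
    rw [← h5] at m3
    exact m3 (swap_apply_of_ne_of_ne m1.symm m2.symm)
  have hequiv : ∀ (g : G) (x : S), (e g : Perm α) (ψ x) =
      ψ ⟨(g : Perm α) x, hmaps g g.2 x x.2⟩ := by
    intro g x
    refine huniq ⟨(g : Perm α) x, hmaps g g.2 x x.2⟩ _ _ (fun w hw => ?_)
      fun w hw => hψ _ w hw
    obtain ⟨y, hy⟩ : ∃ y : S, (g : Perm α) y = w :=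
      ⟨⟨(g : Perm α)⁻¹ w, hmaps _ (G.inv_mem g.2) _ w.2⟩, by simp⟩
    have hyx : y ≠ x := by
      rintro rfl
      exact hw (Subtype.ext hy.symm)
    have hT : T ⟨(g : Perm α) x, hmaps g g.2 x x.2⟩ w * e g = e g * T x y := by
      simp only [T, ← Subgroup.coe_mul, ← map_mul]
      congr 2
      refine Subtype.ext ?_
      simp only [Subgroup.coe_mul, mul_swap_eq_swap_mul, hy]
    have := congrArg (fun t : Perm α => t (ψ x)) hT
    simp only [Perm.mul_apply] at this
    rw [this]
    exact fun h => hψ x y hyx ((e g : Perm α).injective h)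
  classical
  refine ⟨fun x => if hx : x ∈ S then ψ ⟨x, hx⟩ else x, ⟨?_, ?_, ?_⟩, ?_⟩
  · intro x hx
    simp only [dif_pos hx]
    exact (ψ _).2
  · intro x hx y hy h
    simp only [dif_pos hx, dif_pos hy] at h
    exact congrArg Subtype.val (hinj (Subtype.ext h))
  · intro p hp
    obtain ⟨x, hx⟩ := hS.nonempty
    obtain ⟨h, hh⟩ := e.surjective ⟨swap (ψ ⟨x, hx⟩) p, hsw _ (ψ _).2 _ hp⟩
    refine ⟨(h : Perm α) x, hmaps _ h.2 _ hx, ?_⟩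
    simp only [dif_pos (hmaps _ h.2 _ hx)]
    rw [← hequiv h ⟨x, hx⟩, hh]
    exact swap_apply_left _ _
  · intro g x hx
    simp only [dif_pos hx, dif_pos (hmaps _ g.2 _ hx)]
    exact hequiv g ⟨x, hx⟩

end Transpositions

section Slices

theorem exists_slices {a p η x₀ : Fin N → ℤ} {A : Matrix (Fin N) (Fin N) ℤ} (hA : IsOrthMat A)
    (hη : IsDir η) (hη0 : ∃ l, η l ≠ 0) (hx₀ : x₀ ∈ cone p η) (hne : a + A.mulVec x₀ ≠ x₀) :
    ∃ l, η l ≠ 0 ∧ ∃ n₀ : ℕ, ∀ n : ℕ, n₀ ≤ n → ∃ q ∈ cone p η, q l = x₀ l + n * η l ∧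
      ∀ x ∈ cone q (Function.update η l 0), a + A.mulVec x ≠ x := by
  obtain ⟨σ, s, hs, hAs⟩ := orthMat_signed hA
  obtain ⟨i, hi⟩ : ∃ i, a i + s i * x₀ (σ i) ≠ x₀ i := by
    by_contra! h
    exact hne (funext fun i => by rw [Pi.add_apply, hAs, h])
  have hmove : ∀ x : Fin N → ℤ, a i + s i * x (σ i) ≠ x i → a + A.mulVec x ≠ x := by
    intro x hx h
    have := congrFun h i
    rw [Pi.add_apply, hAs] at this
    exact hx this
  have hq : ∀ (l : Fin N) (n : ℕ), Function.update x₀ l (x₀ l + n * η l) ∈ cone p η := by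
    intro l n m
    by_cases hm : m = l
    · subst hm
      obtain ⟨h1, h2⟩ := hx₀ m
      rw [Function.update_self]
      rcases hη m with h | h | h <;> rw [h] at h1 h2 ⊢ <;> constructor <;> grind
    · rw [Function.update_of_ne hm]
      exact hx₀ m
  generalize hj : σ i = j at *
  have hsi := hs i
  have hηi := hη i
  have hηj := hη j
  have hsub : ∀ {l : Fin N} {q x : Fin N → ℤ}, x ∈ cone q (Function.update η l 0) → x l = q l :=
    fun {l q x} hx => (hx l).1 (Function.update_self ..)
  have hz : ∀ {l : Fin N} {q x : Fin N → ℤ} {m : Fin N}, x ∈ cone q (Function.update η l 0) →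
      η m = 0 → x m = q m := fun {l q x m} hx hm => by
    by_cases h : m = l
    · subst h
      exact hsub hx
    · exact (hx m).1 (by rw [Function.update_of_ne h, hm])
  by_cases hi0 : η i = 0
  · by_cases hj0 : η j = 0
    · obtain ⟨l, hl⟩ := hη0
      refine ⟨l, hl, 0, fun n _ => ⟨_, hq l n, Function.update_self .., fun x hx => hmove x ?_⟩⟩
      rw [hz hx hi0, hz hx hj0, Function.update_of_ne (by grind), Function.update_of_ne (by grind)]
      exact hi
    · refine ⟨j, hj0, (a i + s i * x₀ j - x₀ i).natAbs + 1,
        fun n hn => ⟨_, hq j n, Function.update_self .., fun x hx => hmove x ?_⟩⟩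
      rw [hz hx hi0, hsub hx, Function.update_self, Function.update_of_ne (by grind)]
      rcases hsi with h | h <;> rcases hηj with h' | h' | h' <;> rw [h] at hn ⊢ <;>
        rw [h'] <;> omega
  · by_cases hji : j = i
    · subst hji
      rcases hsi with h | h
      · obtain ⟨l, hl⟩ := hη0
        refine ⟨l, hl, 0, fun n _ => ⟨_, hq l n, Function.update_self .., fun x hx => hmove x ?_⟩⟩
        rw [h] at hi ⊢
        omega
      · refine ⟨j, hi0, (a j + s j * x₀ j - x₀ j).natAbs + 1,
          fun n hn => ⟨_, hq j n, Function.update_self .., fun x hx => hmove x ?_⟩⟩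
        rw [hsub hx, Function.update_self]
        rw [h] at hn ⊢
        rcases hηi with h' | h' | h' <;> rw [h'] <;> omega
    · by_cases hj0 : η j = 0
      · refine ⟨i, hi0, (a i + s i * x₀ j - x₀ i).natAbs + 1,
          fun n hn => ⟨_, hq i n, Function.update_self .., fun x hx => hmove x ?_⟩⟩
        rw [hz hx hj0, hsub hx, Function.update_self, Function.update_of_ne hji]
        rcases hηi with h' | h' | h' <;> rw [h'] <;> omega
      · refine ⟨j, hj0, 0, fun n _ => ?_⟩
        obtain ⟨M, hM⟩ : ∃ M : ℕ, M = (a i + s i * (x₀ j + n * η j) - x₀ i).natAbs + 1 := ⟨_, rfl⟩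
        refine ⟨Function.update (Function.update x₀ j (x₀ j + n * η j)) i (x₀ i + M * η i),
          fun m => ?_, ?_, fun x hx => hmove x ?_⟩
        · by_cases hm : m = i
          · subst hm
            rw [Function.update_self]
            have := hq m M m
            rwa [Function.update_self] at this
          · rw [Function.update_of_ne hm]
            exact hq j n m
        · rw [Function.update_of_ne hji, Function.update_self]
        · have h1 := hsub hx
          have h2 := (hx i).2
          rw [Function.update_of_ne hji, Function.update_self] at h1
          rw [Function.update_self, Function.update_of_ne (Ne.symm hji)] at h2
          rw [h1]
          generalize a i + s i * (x₀ j + n * η j) = c at *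
          rcases hηi with h' | h' | h' <;> rw [h'] at h2 <;> omega

variable {S : Set (Fin N → ℤ)} {g : Equiv.Perm (Fin N → ℤ)}

theorem dirRank_le_dirRank_update_add_one (η : Fin N → ℤ) (l : Fin N) :
    dirRank η ≤ dirRank (Function.update η l 0) + 1 := by
  classical
  have : (Finset.univ.filter fun i => η i ≠ 0) ⊆
      insert l (Finset.univ.filter fun i => Function.update η l 0 i ≠ 0) := by
    intro i hi
    by_cases h : i = l
    · simp [h]
    · simpa [h] using hi
  exact (Finset.card_le_card this).trans (Finset.card_insert_le _ _)

/-- An element moving a germ of rank `k + 1` dominates infinitely many disjoint elements moving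
germs of rank `k`. -/
theorem IsPeiPerm.exists_disjoint_of_movesRank (hS : IsPeiMapOn S id) (hg : IsPeiPerm S g) {k : ℕ}
    (h : MovesRank (k + 1) g) :
    ∃ f : ℕ → Equiv.Perm (Fin N → ℤ), (∀ n, IsPeiPerm S (f n)) ∧ (∀ n, MovesRank k (f n)) ∧
      (∀ n x, f n x ≠ x → g x ≠ x) ∧ ∀ m n, m ≠ n → ∀ x, f m x = x ∨ f n x = x := by
  obtain ⟨y, ε, hε, hk, hfr⟩ := h
  obtain ⟨F, hF, hF1, hF2⟩ := hg.exists_cones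
  obtain ⟨⟨p, η⟩, hq, hfq⟩ := frequently_mem_biUnion hF hfr fun t ht => (hF2 _).1 (hg.mem_of_ne ht)
  obtain ⟨hη, a, A, hA, hgA⟩ := hF1 _ hq
  have hLS : cone p η ⊆ S := fun x hx => (hF2 x).2 ⟨_, hq, hx⟩
  have hkη : k + 1 ≤ dirRank η := hk.trans
    (dirRank_le_of_match (ray_frequently_cone hε hη (hfq.mono fun t ht => ht.2)).1)
  obtain ⟨t, hne, hmem⟩ := hfq.exists
  rw [hgA _ hmem] at hne
  obtain ⟨l, hl, n₀, hn⟩ := exists_slices hA hη (by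
    by_contra! h0
    simp only at h0
    simp [dirRank, h0] at hkη) hmem hne
  choose! q hqL hql hqm using hn
  obtain ⟨δ, hδ⟩ : ∃ δ, δ = Function.update η l 0 := ⟨_, rfl⟩
  rw [← hδ] at hqm
  have hδl : δ l = 0 := by rw [hδ, Function.update_self]
  have hδd : IsDir δ := hδ ▸ hη.update l
  have hsub : ∀ n, n₀ ≤ n → cone (q n) δ ⊆ cone p η := by
    intro n hn x hx i
    have h1 := hqL n hn i
    have h2 := hx i
    by_cases hil : i = l
    · subst hil
      rw [h2.1 hδl]
      exact h1
    · rw [hδ, Function.update_of_ne hil] at h2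
      refine ⟨fun h => (h2.1 h).trans (h1.1 h), ?_⟩
      have := add_nonneg h1.2 h2.2
      rwa [← mul_add, add_comm, sub_add_sub_cancel] at this
  have hlx : ∀ n, n₀ ≤ n → ∀ x ∈ cone (q n) δ, x l = (ray y ε t) l + n * η l := by
    intro n hn x hx
    rw [(hx l).1 hδl, hql n hn]
  have hdis : ∀ m n, n₀ ≤ m → n₀ ≤ n → m ≠ n → Disjoint (cone (q m) δ) (cone (q n) δ) := by
    intro m n hm hn hmn
    refine Set.disjoint_left.2 fun x h1 h2 => hmn ?_
    have := (hlx m hm x h1).symm.trans (hlx n hn x h2)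
    have := mul_right_cancel₀ hl (add_left_cancel this)
    exact_mod_cast this
  have hone : ∀ m n, cone (q m - q n + (1 : Matrix (Fin N) (Fin N) ℤ).mulVec (q n))
      ((1 : Matrix (Fin N) (Fin N) ℤ).mulVec δ) = cone (q m) δ := by
    intro m n
    rw [Matrix.one_mulVec, Matrix.one_mulVec, sub_add_cancel]
  have hsw : ∀ n, ∃ w : Equiv.Perm (Fin N → ℤ), IsPeiPerm S w ∧ MovesRank k w ∧
      ∀ x, w x ≠ x → x ∈ cone (q (n₀ + 2 * n)) δ ∨ x ∈ cone (q (n₀ + (2 * n + 1))) δ := by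
    intro n
    have hd := hdis (n₀ + 2 * n) (n₀ + (2 * n + 1)) (by omega) (by omega) (by omega)
    have h1 := (hsub (n₀ + 2 * n) (by omega)).trans hLS
    have h2 := (hsub (n₀ + (2 * n + 1)) (by omega)).trans hLS
    rw [← hone (n₀ + (2 * n + 1)) (n₀ + 2 * n)] at hd h2
    obtain ⟨w, hw, -, hw1, -, hw3⟩ := exists_swap hS isOrthMat_one hδd h1 h2 hd
    refine ⟨w, hw, ⟨q (n₀ + 2 * n), δ, hδd, ?_, ?_⟩, fun x hx => ?_⟩
    · have := dirRank_le_dirRank_update_add_one η l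
      rw [← hδ] at this
      omega
    · refine Filter.Frequently.of_forall fun u hu => ?_
      have hm := ray_mem_cone (self_mem_cone (q (n₀ + 2 * n)) δ) u
      refine Set.disjoint_left.1 hd hm ?_
      rw [← hu, hw1 _ hm]
      exact mulVec_mem_cone isOrthMat_one hm
    · by_contra! hc
      exact hx (hw3 x hc.1 (by rw [hone]; exact hc.2))
  choose f hf1 hf2 hf3 using hsw
  refine ⟨f, hf1, hf2, fun n x hx => ?_, fun m n hmn x => ?_⟩
  · rcases hf3 n x hx with h | h
    · rw [hgA x (hsub _ (by omega) h)]
      exact hqm _ (by omega) x h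
    · rw [hgA x (hsub _ (by omega) h)]
      exact hqm _ (by omega) x h
  · by_contra! hc
    rcases hf3 m x hc.1 with h | h <;> rcases hf3 n x hc.2 with h' | h' <;>
      exact Set.disjoint_left.1 (hdis _ _ (by omega) (by omega) (by omega)) h h'

/-- Along rays of a fixed rank a pei-permutation eventually fixes or eventually moves all points,
and which of the two occurs is governed by an affine condition. -/
theorem IsPeiPerm.exists_fixes_or_moves (hg : IsPeiPerm S g) (x : Fin N → ℤ) {ε : Fin N → ℤ}
    (hε : IsDir ε) :
    ∃ (a : Fin N → ℤ) (A : Matrix (Fin N) (Fin N) ℤ), ∀ y, (∀ i, ε i = 0 → y i = x i) →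
      ((a + A.mulVec y = y ∧ A.mulVec ε = ε) ∧
        ∀ᶠ t in Filter.atTop, g (ray y ε t) = ray y ε t) ∨
      (¬ (a + A.mulVec y = y ∧ A.mulVec ε = ε) ∧
        ∀ᶠ t in Filter.atTop, g (ray y ε t) ≠ ray y ε t) := by
  obtain ⟨a, A, -, h⟩ := hg.exists_affine x hε
  refine ⟨a, A, fun y hy => ?_⟩
  have hy := h y hy
  by_cases hc : a + A.mulVec y = y ∧ A.mulVec ε = ε
  · refine Or.inl ⟨hc, ?_⟩
    rwa [hc.1, hc.2] at hy
  · refine Or.inr ⟨hc, ?_⟩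
    by_contra hev
    have hfr : ∃ᶠ t in Filter.atTop, ray (a + A.mulVec y) (A.mulVec ε) t = ray y ε t := by
      refine ((Filter.not_eventually.1 hev).and_eventually hy).mono fun t ht => ?_
      rw [← ht.2]
      exact not_not.1 ht.1
    rw [Filter.frequently_atTop] at hfr
    obtain ⟨t₁, -, h1⟩ := hfr 0
    obtain ⟨t₂, h12, h2⟩ := hfr (t₁ + 1)
    have hdir : A.mulVec ε = ε := by
      funext i
      have e1 := congrFun h1 i
      have e2 := congrFun h2 i
      simp only [ray] at e1 e2
      have h3 : ((t₂ : ℤ) - t₁) * (A.mulVec ε i - ε i) = 0 := by linear_combination e2 - e1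
      rcases mul_eq_zero.1 h3 with h | h <;> omega
    refine hc ⟨funext fun i => ?_, hdir⟩
    have e1 := congrFun h1 i
    simp only [ray, hdir] at e1
    exact add_right_cancel e1

theorem IsPeiPerm.movesRank_of_disjoint (hg : IsPeiPerm S g) {k : ℕ}
    {f : ℕ → Equiv.Perm (Fin N → ℤ)} (hf : ∀ n, IsPeiPerm S (f n)) (hm : ∀ n, MovesRank k (f n))
    (hsub : ∀ n x, f n x ≠ x → g x ≠ x) (hdis : ∀ m n, m ≠ n → ∀ x, f m x = x ∨ f n x = x) :
    MovesRank (k + 1) g := by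
  by_contra hk
  obtain ⟨F, hF, hcov⟩ := hg.exists_finite_cover hk
  choose x ε hε hkε hfr using hm
  have hq : ∀ n, ∃ q ∈ F, q.2 = ε n ∧ ∀ i, ε n i = 0 → x n i = q.1 i := fun n =>
    hcov _ _ (hε n) (hkε n) ((hfr n).mono fun t => hsub n _)
  choose q hqF hqε hqx using hq
  have : Finite F := hF
  obtain ⟨m, n, hmn, heq⟩ := Finite.exists_ne_map_eq_of_infinite fun n => (⟨q n, hqF n⟩ : F)
  have heq : q m = q n := congrArg Subtype.val heq
  have hεmn : ε n = ε m := by rw [← hqε, ← hqε, heq]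
  have hfn := hfr n
  have hxn := hqx n
  rw [hεmn] at hfn hxn
  have hx12 : ∀ i, ε m i = 0 → x n i = x m i := fun i hi => by
    rw [hxn i hi, hqx m i hi, heq]
  obtain ⟨a, A, hA⟩ := (hf m).exists_fixes_or_moves (x m) (hε m)
  obtain ⟨b, B, hB⟩ := (hf n).exists_fixes_or_moves (x m) (hε m)
  have key : ∀ y, (∀ i, ε m i = 0 → y i = x m i) →
      (a + A.mulVec y = y ∧ A.mulVec (ε m) = ε m) ∨ (b + B.mulVec y = y ∧ B.mulVec (ε m) = ε m) := by
    intro y hy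
    by_contra! hc
    rcases hA y hy with h | h
    · exact hc.1 h.1.1 h.1.2
    rcases hB y hy with h' | h'
    · exact hc.2 h'.1.1 h'.1.2
    obtain ⟨t, h1, h2⟩ := (h.2.and h'.2).exists
    exact (hdis m n hmn _).elim h1 h2
  have hAm : ¬ (a + A.mulVec (x m) = x m ∧ A.mulVec (ε m) = ε m) := by
    intro hc
    rcases hA _ fun _ _ => rfl with h | h
    · exact hfr m (h.2.mono fun t ht => not_not.2 ht)
    · exact h.1 hc
  have hBn : ¬ (b + B.mulVec (x n) = x n ∧ B.mulVec (ε m) = ε m) := by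
    intro hc
    rcases hB _ hx12 with h | h
    · exact hfn (h.2.mono fun t ht => not_not.2 ht)
    · exact h.1 hc
  obtain ⟨hB1, hB2⟩ := (key _ fun _ _ => rfl).resolve_left hAm
  obtain ⟨hA1, hA2⟩ := (key _ hx12).resolve_right hBn
  have hlin : ∀ C : Matrix (Fin N) (Fin N) ℤ,
      C.mulVec (x n + x n - x m) = C.mulVec (x n) + C.mulVec (x n) - C.mulVec (x m) := fun C => by
    rw [Matrix.mulVec_sub, Matrix.mulVec_add]
  rcases key (x n + x n - x m) fun i hi => by
    simp only [Pi.sub_apply, Pi.add_apply, hx12 i hi, add_sub_cancel_right] with h | h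
  · refine hAm ⟨funext fun i => ?_, hA2⟩
    have e1 := congrFun hA1 i
    have e2 := congrFun h.1 i
    rw [hlin] at e2
    simp only [Pi.sub_apply, Pi.add_apply] at e1 e2 ⊢
    omega
  · refine hBn ⟨funext fun i => ?_, hB2⟩
    have e1 := congrFun hB1 i
    have e2 := congrFun h.1 i
    rw [hlin] at e2
    simp only [Pi.sub_apply, Pi.add_apply] at e1 e2 ⊢
    omega

theorem IsPeiPerm.infinite_of_movesRank (hg : IsPeiPerm S g) {k : ℕ} (h : MovesRank (k + 1) g) :
    S.Infinite := by
  obtain ⟨x, ε, hε, hk, hfr⟩ := h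
  obtain ⟨i, hi⟩ : ∃ i, ε i ≠ 0 := by
    by_contra! h0
    simp [dirRank, h0] at hk
  have hinj : Function.Injective (ray x ε) := fun s t hst => by
    have := congrFun hst i
    simp only [ray] at this
    exact_mod_cast mul_right_cancel₀ hi (add_left_cancel this)
  refine ((Nat.frequently_atTop_iff_infinite.1 hfr).image hinj.injOn).mono ?_
  rintro _ ⟨t, ht, rfl⟩
  exact hg.mem_of_ne ht

/-- Automorphisms of `pei(S)` preserve the ranks of elements. -/
theorem movesRank_map {G : Subgroup (Equiv.Perm (Fin N → ℤ))} (hG : ∀ g, g ∈ G ↔ IsPeiPerm S g)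
    (k : ℕ) : ∀ (e : G ≃* G) (g : G), MovesRank k (g : Equiv.Perm (Fin N → ℤ)) →
      MovesRank k (e g : Equiv.Perm (Fin N → ℤ)) := by
  classical
  have hS : IsPeiMapOn S id := ((hG 1).1 G.one_mem).isPeiMapOn_id
  have hfix : ∀ g ∈ G, ∀ x ∉ S, g x = x := fun g hg => ((hG g).1 hg).2
  have hsw : ∀ x ∈ S, ∀ y ∈ S, Equiv.swap x y ∈ G := fun x hx y hy =>
    (hG _).2 (isPeiPerm_swap hS hx hy)
  induction k with
  | zero =>
    intro e g h
    by_contra hc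
    rw [not_movesRank_zero_iff] at hc
    have : e g = 1 := Subtype.ext hc
    refine not_movesRank_zero_iff.2 ?_ h
    rw [(map_eq_one_iff e e.injective).1 this, Subgroup.coe_one]
  | succ k ih =>
    intro e g h
    have hg := (hG g).1 g.2
    obtain ⟨φ, hφ, hφe⟩ := exists_spatial (hg.infinite_of_movesRank h) hfix hsw e
    have hiff : ∀ (u : G), ∀ x ∈ S, (e u : Equiv.Perm (Fin N → ℤ)) (φ x) = φ x ↔
        (u : Equiv.Perm (Fin N → ℤ)) x = x := fun u x hx => by
      rw [hφe u x hx]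
      exact hφ.injOn.eq_iff (((hG u).1 u.2).mapsTo.2 hx) hx
    obtain ⟨f, hf1, hf2, hf3, hf4⟩ := hg.exists_disjoint_of_movesRank hS h
    let u : ℕ → G := fun n => ⟨f n, (hG _).2 (hf1 n)⟩
    refine ((hG _).1 (e g).2).movesRank_of_disjoint (f := fun n => e (u n))
      (fun n => (hG _).1 (e (u n)).2) (fun n => ih e (u n) (hf2 n)) (fun n y hy => ?_)
      fun m n hmn y => ?_
    · obtain ⟨x, hx, rfl⟩ := hφ.surjOn (((hG _).1 (e (u n)).2).mem_of_ne hy)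
      rw [Ne, hiff _ x hx] at hy ⊢
      exact hf3 n x hy
    · by_cases hy : y ∈ S
      · obtain ⟨x, hx, rfl⟩ := hφ.surjOn hy
        rw [hiff _ x hx, hiff _ x hx]
        exact hf4 m n hmn x
      · exact Or.inl (hfix _ (e (u m)).2 y hy)

end Slices

end Helpers

/-- `pei(S)` satisfies the maximal condition on normal subgroups, and the
rank subgroups `G_k` are characteristic. -/
theorem stmt16 {N : ℕ} (S : Set (Fin N → ℤ)) (hS : IsOrthohedral S)
    (G : Subgroup (Equiv.Perm (Fin N → ℤ)))
    (hG : (G : Set (Equiv.Perm (Fin N → ℤ))) = {g | IsPeiPerm S g}) :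
    (∀ c : ℕ → Subgroup ↥G, Monotone c → (∀ n, (c n).Normal) →
      ∃ n, ∀ m, n ≤ m → c m = c n) ∧
    (∀ (k : ℕ) (e : ↥G ≃* ↥G) (g : ↥G),
      rankLE (↑g : Equiv.Perm (Fin N → ℤ)) k ↔
        rankLE (↑(e g) : Equiv.Perm (Fin N → ℤ)) k) := by
  have hG' : ∀ g, g ∈ G ↔ IsPeiPerm S g := fun g => Set.ext_iff.1 hG g
  refine ⟨fun c hc hn => ?_, fun k e g => ?_⟩
  · obtain ⟨n, h⟩ := stableOn_lowRank hG' hc hn (N + 1)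
    exact ⟨n, fun m hm => le_antisymm
      (fun g hg => h m hm g hg (not_movesRank_of_lt (Nat.lt_succ_self N) _)) (hc hm)⟩
  · rw [((hG' _).1 g.2).rankLE_iff, ((hG' _).1 (e g).2).rankLE_iff, not_iff_not]
    refine ⟨movesRank_map hG' _ e g, fun h => ?_⟩
    simpa using movesRank_map hG' _ e.symm (e g) h

end PeiPaper
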